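/- arXiv:1903.10133 — 8 statements merged into one kernel-verified Lean document; each statement's English description precedes it below -/
import Mathlib

section
/- For every finite simple graph G, if mad(G) ≤ 8/3 (that is, every nonempty vertex subset A spans at most 4|A|/3 edges, i.e. 3·e(A) ≤ 4·|A|), then G admits a star 5-coloring; in other words, χ_s(G) ≤ 5. -/
open scoped Classical

/-- `c` is a *star coloring* of `G` with colors in `Fin k`: a proper coloring such that
no path on four distinct vertices receives only two colors. -/
def IsStarColoring {W : Type*} {k : ℕ} (G : SimpleGraph W) (c : W → Fin k) : Prop :=
  (∀ u v, G.Adj u v → c u ≠ c v) ∧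
    ∀ u v w x : W, u ≠ v → u ≠ w → u ≠ x → v ≠ w → v ≠ x → w ≠ x →
      G.Adj u v → G.Adj v w → G.Adj w x → ¬(c u = c w ∧ c v = c x)

/-- The number of edges of `G` with both endpoints in the vertex subset `A`. -/
noncomputable def edgesIn {W : Type*} [Fintype W] (G : SimpleGraph W) (A : Finset W) : ℕ :=
  (Finset.univ.filter fun e : Sym2 W => e ∈ G.edgeSet ∧ ∀ v ∈ e, v ∈ A).card

/-- Three tokens on every edge are distributed among its endpoints, where `a u v` is the number
of tokens of the edge `uv` held by `u`, and no vertex holds more than four tokens. -/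
structure IsTokenAssignment {V : Type*} [Fintype V] (G : SimpleGraph V) (a : V → V → ℕ) :
    Prop where
  add_eq : ∀ u v, G.Adj u v → a u v + a v u = 3
  eq_zero : ∀ u v, ¬G.Adj u v → a u v = 0
  sum_le : ∀ u, ∑ v, a u v ≤ 4

theorem exists_isTokenAssignment {V : Type*} [Fintype V] (G : SimpleGraph V)
    (hmad : ∀ A : Finset V, A.Nonempty → 3 * edgesIn G A ≤ 4 * A.card) :
    ∃ a, IsTokenAssignment G a := by
  let t : G.edgeSet × Fin 3 → Finset (V × Fin 4) := fun p =>
    Finset.univ.filter fun q => q.1 ∈ p.1.1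
  have hall : ∀ s : Finset (G.edgeSet × Fin 3), s.card ≤ (s.biUnion t).card := by
    intro s
    rcases s.eq_empty_or_nonempty with rfl | hs
    · simp
    let X : Finset V := Finset.univ.filter fun v => ∃ p ∈ s, v ∈ p.1.1
    have hX : X.Nonempty := by
      obtain ⟨p, hp⟩ := hs
      obtain ⟨⟨e, he⟩, i⟩ := p
      induction e with
      | _ x y => exact ⟨x, Finset.mem_filter.2 ⟨Finset.mem_univ _, _, hp, Sym2.mem_mk_left x y⟩⟩
    have h1 : s.biUnion t = X ×ˢ Finset.univ := by
      ext ⟨v, i⟩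
      simp [X, t]
    have h2 : s.card ≤ 3 * edgesIn G X := by
      have : s ⊆ (s.image Prod.fst) ×ˢ Finset.univ := by
        intro p hp
        simp only [Finset.mem_product, Finset.mem_univ, and_true]
        exact Finset.mem_image_of_mem _ hp
      have h3 := Finset.card_le_card this
      rw [Finset.card_product, Finset.card_univ, Fintype.card_fin] at h3
      have h4 : (s.image Prod.fst).card ≤ edgesIn G X := by
        apply Finset.card_le_card_of_injOn Subtype.val
        · intro e he
          obtain ⟨p, hp, rfl⟩ := Finset.mem_image.1 he
          simp only [Finset.coe_filter, Finset.mem_univ, true_and, Set.mem_ofPred_eq]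
          refine ⟨p.1.2, fun v hv => ?_⟩
          exact Finset.mem_filter.2 ⟨Finset.mem_univ _, p, hp, hv⟩
        · exact Subtype.val_injective.injOn
      omega
    have h5 := hmad X hX
    rw [h1, Finset.card_product, Finset.card_univ, Fintype.card_fin]
    omega
  obtain ⟨f, hf, hft⟩ := (Finset.all_card_le_biUnion_card_iff_exists_injective t).1 hall
  have hmem : ∀ p, (f p).1 ∈ p.1.1 := fun p => by simpa [t] using hft p
  refine ⟨fun u v => (Finset.univ.filter fun p => p.1.1 = s(u, v) ∧ (f p).1 = u).card,
    ?_, ?_, ?_⟩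
  · intro u v huv
    rw [← Finset.card_union_of_disjoint]
    · have : (Finset.univ.filter fun p : G.edgeSet × Fin 3 => p.1.1 = s(u, v) ∧ (f p).1 = u) ∪
          (Finset.univ.filter fun p => p.1.1 = s(v, u) ∧ (f p).1 = v) =
          {(⟨s(u, v), huv⟩ : G.edgeSet)} ×ˢ Finset.univ := by
        ext ⟨⟨e, he⟩, i⟩
        have := hmem (⟨e, he⟩, i)
        simp only [Finset.mem_union, Finset.mem_filter, Finset.mem_univ, true_and,
          Finset.mem_product, Finset.mem_singleton, and_true,
          Sym2.eq_swap (a := v) (b := u), ← and_or_left]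
        rw [Subtype.ext_iff, and_iff_left_iff_imp]
        rintro rfl
        simpa using this
      rw [this]
      simp
    · rw [Finset.disjoint_left]
      intro p hp hq
      simp only [Finset.mem_filter] at hp hq
      exact huv.ne (hp.2.2.symm.trans hq.2.2)
  · intro u v huv
    rw [Finset.card_eq_zero, Finset.filter_eq_empty_iff]
    rintro p - ⟨hp, -⟩
    exact huv (by simpa [hp] using p.1.2)
  · intro u
    rw [← Finset.card_biUnion]
    · calc _ ≤ (({u} : Finset V) ×ˢ (Finset.univ : Finset (Fin 4))).card := by
            apply Finset.card_le_card_of_injOn f _ hf.injOn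
            intro p hp
            simp only [Finset.coe_biUnion, Set.mem_iUnion, Finset.coe_filter,
              Set.mem_ofPred_eq] at hp
            obtain ⟨v, -, -, -, h⟩ := hp
            exact Finset.mem_product.2 ⟨Finset.mem_singleton.2 h, Finset.mem_univ _⟩
        _ ≤ 4 := by simp
    · intro v _ w _ hvw
      rw [Function.onFun, Finset.disjoint_left]
      intro p hp hq
      simp only [Finset.mem_filter] at hp hq
      have := hp.2.1.symm.trans hq.2.1
      exact hvw (Sym2.congr_right.1 this)

theorem Relation.ReflTransGen.exists_nodup_isChain {α : Type*} {R : α → α → Prop} {d p : α}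
    (h : Relation.ReflTransGen R d p) :
    ∃ l : List α, (d :: l).IsChain R ∧ (d :: l).Nodup ∧
      (d :: l).getLast (List.cons_ne_nil d l) = p := by
  induction h using Relation.ReflTransGen.head_induction_on with
  | refl => exact ⟨[], by simp⟩
  | @head x y hxy _ ih =>
    obtain ⟨l, hl, hn, hp⟩ := ih
    by_cases hx : x ∈ y :: l
    · obtain ⟨s, t, hst⟩ := List.append_of_mem hx
      have hsuf : x :: t <:+ y :: l := ⟨s, hst.symm⟩
      exact ⟨t, hl.suffix hsuf, hn.sublist hsuf.sublist, by
        rw [← hp, hsuf.getLast]⟩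
    · exact ⟨y :: l, List.isChain_cons_cons.2 ⟨hxy, hl⟩, List.nodup_cons.2 ⟨hx, hn⟩, by
        rwa [List.getLast_cons (List.cons_ne_nil y l)]⟩

theorem Relation.ReflTransGen.exists_perm {α : Type*} {R : α → α → Prop} {d p : α}
    (h : Relation.ReflTransGen R d p) :
    ∃ f : Equiv.Perm α, f p = d ∧ ∀ x, x ≠ p → f x ≠ x → R x (f x) := by
  obtain ⟨l, hl, hn, hp⟩ := h.exists_nodup_isChain
  refine ⟨(d :: l).formPerm, ?_, fun x hxp hx => ?_⟩
  · rw [← hp, List.formPerm_apply_getLast]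
  · have hmem : x ∈ d :: l := by
      by_contra hx'
      exact hx (List.formPerm_apply_of_notMem hx')
    obtain ⟨i, hi, rfl⟩ := List.getElem_of_mem hmem
    have hi' : i + 1 < (d :: l).length := by
      by_contra hlt
      apply hxp
      rw [← hp, List.getLast_eq_getElem]
      congr 1
      omega
    rw [List.formPerm_apply_lt_getElem _ hn i hi']
    exact List.isChain_iff_getElem.1 hl i hi'

section Tokens

variable {V : Type*} [Fintype V] {G : SimpleGraph V} {a : V → V → ℕ}

theorem IsTokenAssignment.self_eq_zero (ha : IsTokenAssignment G a) (v : V) : a v v = 0 :=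
  ha.eq_zero v v G.irrefl

theorem IsTokenAssignment.add_le (ha : IsTokenAssignment G a) (u v : V) :
    a u v + a v u ≤ 3 := by
  by_cases h : G.Adj u v
  · exact (ha.add_eq u v h).le
  · simp [ha.eq_zero u v h, ha.eq_zero v u (fun h' => h h'.symm)]

theorem IsTokenAssignment.add_eq_of_pos (ha : IsTokenAssignment G a) {u v : V}
    (h : 0 < a u v) : a u v + a v u = 3 := by
  by_cases h' : G.Adj u v
  · exact ha.add_eq u v h'
  · exact absurd (ha.eq_zero u v h') h.ne'

/-- Tokens can be pushed around the cycles of a permutation. -/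
theorem IsTokenAssignment.push (ha : IsTokenAssignment G a) (f : Equiv.Perm V)
    (hf : ∀ x, f x ≠ x → 2 ≤ a x (f x)) :
    ∃ a', IsTokenAssignment G a' ∧ (∀ x y, a' x y = 3 → a x y = 3) ∧
      ∀ x, f x ≠ x → a' x (f x) ≠ 3 := by
  have hR : ∀ x y, y = f x → x ≠ y → 2 ≤ a x y := by
    rintro x y rfl h
    exact hf x h.symm
  let b : V → V → ℕ := fun x y => if y = f x ∧ x ≠ y then 1 else 0
  have hb : ∀ x y, b x y = 0 ∨ b x y = 1 ∧ 2 ≤ a x y := by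
    intro x y
    by_cases h : y = f x ∧ x ≠ y
    · exact Or.inr ⟨if_pos h, hR x y h.1 h.2⟩
    · exact Or.inl (if_neg h)
  refine ⟨fun x y => a x y + b y x - b x y, ⟨?_, ?_, ?_⟩, ?_, ?_⟩
  · intro u v huv
    have := ha.add_eq u v huv
    have := hb u v
    have := hb v u
    grind
  · intro u v huv
    have := ha.eq_zero u v huv
    have := ha.eq_zero v u (fun h' => huv h'.symm)
    have := hb u v
    have := hb v u
    grind
  · intro u
    have h1 : ∑ v, b u v = ∑ v, b v u := by
      have h2 : ∀ v, b v u = if v = f.symm u then if f u ≠ u then 1 else 0 else 0 := by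
        intro v
        simp only [b]
        grind [Equiv.symm_apply_eq, Equiv.apply_symm_apply]
      have h3 : ∀ v, b u v = if v = f u then if f u ≠ u then 1 else 0 else 0 := by
        intro v
        simp only [b]
        grind
      simp only [h2, h3, Finset.sum_ite_eq', Finset.mem_univ, if_true]
    have h2 : ∑ v, (a u v + b v u - b u v) + ∑ v, b u v = ∑ v, a u v + ∑ v, b v u := by
      rw [← Finset.sum_add_distrib, ← Finset.sum_add_distrib]
      refine Finset.sum_congr rfl fun v _ => ?_
      have := hb u v
      grind
    have := ha.sum_le u
    show ∑ v, (a u v + b v u - b u v) ≤ 4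
    omega
  · intro x y h
    have := hb x y
    have := hb y x
    have := ha.add_le x y
    grind
  · intro x hx h
    have h1 : b x (f x) = 1 := if_pos ⟨rfl, hx.symm⟩
    have := hb (f x) x
    have := ha.add_le x (f x)
    have := hf x hx
    grind

/-- An assignment with the fewest edges whose tokens all lie at one end has no such edge on a
directed cycle. -/
theorem exists_isTokenAssignment_acyclic (ha : ∃ a, IsTokenAssignment G a) :
    ∃ a, IsTokenAssignment G a ∧
      ∀ p d, a p d = 3 → ¬Relation.ReflTransGen (fun u v => 2 ≤ a u v) d p := by
  let μ : (V → V → ℕ) → ℕ := fun a => (Finset.univ.filter fun q : V × V => a q.1 q.2 = 3).card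
  obtain ⟨a, ha, hmin⟩ := WellFounded.has_min (measure μ).wf {a | IsTokenAssignment G a} ha
  refine ⟨a, ha, fun p d hpd hdp => ?_⟩
  obtain ⟨f, hfp, hf⟩ := hdp.exists_perm
  have hne : d ≠ p := by
    rintro rfl
    have := IsTokenAssignment.self_eq_zero ha d
    omega
  obtain ⟨a', ha', hle, hlt⟩ := IsTokenAssignment.push ha f (fun x hx => by
    by_cases hxp : x = p
    · subst hxp
      rw [hfp, hpd]
      norm_num
    · exact hf x hxp hx)
  refine hmin a' ha' (Finset.card_lt_card (Finset.ssubset_iff_of_subset ?_ |>.2 ⟨(p, d), ?_, ?_⟩))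
  · intro q
    simpa using hle q.1 q.2
  · simpa using hpd
  · have := hlt p (by rwa [hfp])
    rw [hfp] at this
    simpa using this

end Tokens

/-- Two distinct vertices are siblings if they have a common in-neighbor. -/
def Sibling {V : Type*} (R : V → V → Prop) (x y : V) : Prop :=
  x ≠ y ∧ ∃ d, R d x ∧ R d y

theorem Sibling.symm {V : Type*} {R : V → V → Prop} {x y : V} (h : Sibling R x y) :
    Sibling R y x := by
  obtain ⟨hne, d, hx, hy⟩ := h
  exact ⟨hne.symm, d, hy, hx⟩

/-- The out-neighbors, second out-neighbors and siblings of a vertex. -/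
noncomputable def conflictSet {V : Type*} [Fintype V] (R : V → V → Prop) (v : V) : Finset V :=
  Finset.univ.filter fun w => R v w ∨ (∃ u, R v u ∧ R u w) ∨ Sibling R v w

/-- The orientations of `G` from which a star 5-coloring can be built. A vertex `z` lies on a
directed cycle exactly if `Relation.TransGen R z z`. -/
structure IsSparseOrientation {V : Type*} [Fintype V] (G : SimpleGraph V)
    (R : V → V → Prop) : Prop where
  adj_iff : ∀ u v, G.Adj u v ↔ R u v ∨ R v u
  asymm : ∀ u v, R u v → ¬R v u
  card_conflictSet_le : ∀ v, (conflictSet R v).card ≤ 4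
  eq_or_eq : ∀ v x y, R v x → R v y → x ≠ y → ∀ w, R v w → w = x ∨ w = y
  not_sibling : ∀ v x y, R v x → R v y → x ≠ y → ∀ w, ¬Sibling R v w
  cyclic_out : ∀ z, Relation.TransGen R z z → ∀ x y, R z x → R z y → x = y
  cyclic_sibling : ∀ z, Relation.TransGen R z z →
    ∀ x y, Sibling R z x → Sibling R z y → x = y
  sibling_of_cyclic : ∀ z, Relation.TransGen R z z → ∀ s, Sibling R z s →
    ∀ u, ¬Relation.TransGen R u u → R u z → (∀ w, R u w → w = z) →
      ∀ x y, Sibling R u x → Sibling R u y → x = y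

section Tokens

variable {V : Type*} [Fintype V] {G : SimpleGraph V} {a : V → V → ℕ}

namespace IsTokenAssignment

theorem sum_subset_le (ha : IsTokenAssignment G a) (v : V) (T : Finset V) :
    ∑ w ∈ T, a v w ≤ 4 :=
  (Finset.sum_le_sum_of_subset (Finset.subset_univ T)).trans (ha.sum_le v)

theorem asymm (ha : IsTokenAssignment G a) {u v : V} (h : 2 ≤ a u v) : ¬2 ≤ a v u := by
  have := ha.add_le u v
  omega

theorem add_add_le (ha : IsTokenAssignment G a) {v x y w : V} (hxy : x ≠ y) (hwx : w ≠ x)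
    (hwy : w ≠ y) : a v x + a v y + a v w ≤ 4 := by
  have := ha.sum_subset_le v {x, y, w}
  rw [Finset.sum_insert (by simp [hxy, hwx.symm]), Finset.sum_pair hwy.symm] at this
  omega

theorem add_le_four (ha : IsTokenAssignment G a) {v x y : V} (hxy : x ≠ y) :
    a v x + a v y ≤ 4 := by
  have := ha.sum_subset_le v {x, y}
  rwa [Finset.sum_pair hxy] at this

theorem eq_or_eq (ha : IsTokenAssignment G a) {v x y w : V} (hx : 2 ≤ a v x) (hy : 2 ≤ a v y)
    (hxy : x ≠ y) (hw : 0 < a v w) : w = x ∨ w = y := by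
  by_contra! h
  have := ha.add_add_le (v := v) hxy h.1 h.2
  omega

theorem eq_two (ha : IsTokenAssignment G a) {v x y : V} (hx : 2 ≤ a v x) (hy : 2 ≤ a v y)
    (hxy : x ≠ y) : a v x = 2 := by
  have := ha.add_le_four (v := v) hxy
  omega

theorem eq_three (ha : IsTokenAssignment G a) {u v x y : V} (hu : 2 ≤ a u v) (hx : 2 ≤ a v x)
    (hy : 2 ≤ a v y) (hxy : x ≠ y) : a u v = 3 := by
  have h1 := ha.add_eq_of_pos (u := u) (v := v) (by omega)
  by_contra h
  have h2 := ha.asymm hu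
  rcases ha.eq_or_eq hx hy hxy (w := u) (by omega) with rfl | rfl
  · exact h2 hx
  · exact h2 hy

theorem not_sibling (ha : IsTokenAssignment G a) {v x y w : V} (hx : 2 ≤ a v x)
    (hy : 2 ≤ a v y) (hxy : x ≠ y) : ¬Sibling (fun u v => 2 ≤ a u v) v w := by
  rintro ⟨hvw, d, hdv, hdw⟩
  have := ha.eq_three hdv hx hy hxy
  have := ha.eq_two hdv hdw hvw
  omega

/-- A vertex spends at least one token for each of its siblings. -/
theorem card_sibling_add_sum_le (ha : IsTokenAssignment G a) (v : V) (T : Finset V)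
    (hT : ∀ t ∈ T, ∀ y, 2 ≤ a t v → 2 ≤ a t y → y = v) :
    (Finset.univ.filter fun y => Sibling (fun u v => 2 ≤ a u v) v y).card + ∑ t ∈ T, a v t ≤ 4 := by
  set S := Finset.univ.filter fun y => Sibling (fun u v => 2 ≤ a u v) v y with hS
  have hd : ∀ y ∈ S, ∃ d, 2 ≤ a d v ∧ 2 ≤ a d y := by
    intro y hy
    simp only [hS, Finset.mem_filter, Finset.mem_univ, true_and] at hy
    exact hy.2
  have hne : ∀ y ∈ S, v ≠ y := by
    intro y hy
    simp only [hS, Finset.mem_filter, Finset.mem_univ, true_and] at hy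
    exact hy.1
  choose! d hdv hdy using hd
  have hinj : Set.InjOn d S := by
    intro x hx y hy hxy
    rcases ha.eq_or_eq (hdv x hx) (hdy x hx) (hne x hx) (w := y)
      (by have := hdy y hy; rw [hxy]; omega) with h | h
    · exact absurd h.symm (hne y hy)
    · exact h.symm
  have hdisj : Disjoint (S.image d) T := by
    rw [Finset.disjoint_left]
    intro t ht htT
    obtain ⟨y, hy, rfl⟩ := Finset.mem_image.1 ht
    exact hne y hy (hT _ htT y (hdv y hy) (hdy y hy)).symm
  have h1 : S.card ≤ ∑ t ∈ S.image d, a v t := by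
    rw [Finset.sum_image hinj, Finset.card_eq_sum_ones]
    refine Finset.sum_le_sum fun y hy => ?_
    have := ha.eq_two (hdv y hy) (hdy y hy) (hne y hy)
    have := ha.add_eq_of_pos (u := d y) (v := v) (by omega)
    omega
  have h2 := ha.sum_subset_le v (S.image d ∪ T)
  rw [Finset.sum_union hdisj] at h2
  omega

theorem card_conflictSet_le (ha : IsTokenAssignment G a) (v : V) :
    (conflictSet (fun u v => 2 ≤ a u v) v).card ≤ 4 := by
  set R : V → V → Prop := fun u v => 2 ≤ a u v with hR
  let O : V → Finset V := fun v => Finset.univ.filter (R v)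
  let S := Finset.univ.filter (Sibling R v)
  have hO : ∀ u, (O u).card ≤ 2 := by
    intro u
    by_contra! h
    obtain ⟨x, y, w, hx, hy, hw, hxy, hxw, hyw⟩ := Finset.two_lt_card_iff.1 h
    simp only [O, hR, Finset.mem_filter, Finset.mem_univ, true_and] at hx hy hw
    have := ha.add_add_le (v := u) hxy hxw.symm hyw.symm
    omega
  have hS : S.card + ∑ w ∈ O v, a v w ≤ 4 := by
    refine ha.card_sibling_add_sum_le v (O v) fun t ht y h => ?_
    simp only [O, Finset.mem_filter, Finset.mem_univ, true_and] at ht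
    exact absurd h (ha.asymm ht)
  have hK : conflictSet R v = O v ∪ (O v).biUnion O ∪ S := by
    ext w
    simp [conflictSet, O, S]
  have hcard : (conflictSet R v).card ≤ (O v).card + ((O v).biUnion O).card + S.card := by
    rw [hK]
    exact (Finset.card_union_le _ _).trans (Nat.add_le_add_right (Finset.card_union_le _ _) _)
  have htwo : ∀ u, (O u).card = 2 → ∃ x y, x ≠ y ∧ O u = {x, y} ∧ R u x ∧ R u y := by
    intro u hu
    obtain ⟨x, y, hxy, h⟩ := Finset.card_eq_two.1 hu
    have hx : x ∈ O u := by simp [h]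
    have hy : y ∈ O u := by simp [h]
    exact ⟨x, y, hxy, h, by simpa [O] using hx, by simpa [O] using hy⟩
  have h3 := hO v
  interval_cases hv : (O v).card
  · rw [Finset.card_eq_zero] at hv
    simp only [hv, Finset.biUnion_empty, Finset.card_empty] at hcard
    omega
  · obtain ⟨w, hw⟩ := Finset.card_eq_one.1 hv
    have hvw : R v w := by
      have : w ∈ O v := by simp [hw]
      simpa [O] using this
    rw [hw, Finset.sum_singleton] at hS
    rw [hw, Finset.singleton_biUnion] at hcard
    have := hO w
    rcases this.eq_or_lt with h | h
    · obtain ⟨x, y, hxy, -, hx, hy⟩ := htwo w h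
      have := ha.eq_three hvw hx hy hxy
      omega
    · have : 2 ≤ a v w := hvw
      omega
  · obtain ⟨x, y, hxy, hO', hx, hy⟩ := htwo v hv
    have hS0 : S.card = 0 := by
      rw [Finset.card_eq_zero, Finset.filter_eq_empty_iff]
      intro w _
      exact ha.not_sibling hx hy hxy
    have h1 : ∀ u ∈ O v, (O u).card ≤ 1 := by
      intro u hu
      by_contra! h
      obtain ⟨x', y', hxy', -, hx', hy'⟩ := htwo u (le_antisymm (hO u) h)
      have hvu : R v u := by simpa [O] using hu
      have h3 := ha.eq_three hvu hx' hy' hxy'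
      rw [hO', Finset.mem_insert, Finset.mem_singleton] at hu
      rcases hu with rfl | rfl
      · have := ha.eq_two hx hy hxy
        omega
      · have := ha.eq_two hy hx hxy.symm
        omega
    have := Finset.card_biUnion_le_card_mul (O v) O 1 h1
    omega

/-- The arcs carry at least two of the three tokens of their edges. -/
theorem isSparseOrientation (ha : IsTokenAssignment G a)
    (hcyc : ∀ p d, a p d = 3 → ¬Relation.ReflTransGen (fun u v => 2 ≤ a u v) d p) :
    IsSparseOrientation G fun u v => 2 ≤ a u v := by
  have hout : ∀ z, Relation.TransGen (fun u v => 2 ≤ a u v) z z →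
      ∀ x y, 2 ≤ a z x → 2 ≤ a z y → x = y := by
    intro z hz x y hx hy
    by_contra hxy
    obtain ⟨p, hzp, hpz⟩ := Relation.TransGen.tail'_iff.1 hz
    exact hcyc p z (ha.eq_three hpz hx hy hxy) hzp
  have hpre : ∀ z, Relation.TransGen (fun u v => 2 ≤ a u v) z z →
      ∃ p w, p ≠ w ∧ 2 ≤ a p z ∧ a z p = 1 ∧ a z w = 2 ∧
        Relation.TransGen (fun u v => 2 ≤ a u v) p p ∧
        Relation.TransGen (fun u v => 2 ≤ a u v) w w := by
    intro z hz
    obtain ⟨p, hzp, hpz⟩ := Relation.TransGen.tail'_iff.1 hz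
    obtain ⟨w, hzw, hwz⟩ := Relation.TransGen.head'_iff.1 hz
    have h1 := ha.add_eq_of_pos (u := p) (v := z) (by omega)
    have h2 := ha.add_le z w
    have h3 : a p z ≠ 3 := fun h => hcyc p z h hzp
    have h4 : a z w ≠ 3 := fun h => hcyc z w h hwz
    refine ⟨p, w, ?_, hpz, by omega, by omega, Relation.TransGen.head' hpz hzp,
      Relation.TransGen.tail' hwz hzw⟩
    rintro rfl
    omega
  refine ⟨?_, fun u v h => ha.asymm h, ha.card_conflictSet_le, ?_, ?_, hout, ?_, ?_⟩
  · intro u v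
    constructor
    · intro h
      have := ha.add_eq u v h
      omega
    · contrapose
      intro h
      have := ha.eq_zero u v h
      have := ha.eq_zero v u fun h' => h h'.symm
      omega
  · intro v x y hx hy hxy w hw
    exact ha.eq_or_eq hx hy hxy (by omega)
  · intro v x y hx hy hxy w
    exact ha.not_sibling hx hy hxy
  · intro z hz x y hx hy
    obtain ⟨p, w, hpw, hpz, hp1, hw2, hpp, -⟩ := hpre z hz
    have h := ha.card_sibling_add_sum_le z {p, w} (by
      intro t ht y h1 h2
      rw [Finset.mem_insert, Finset.mem_singleton] at ht
      rcases ht with rfl | rfl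
      · exact hout _ hpp _ _ h2 h1
      · exact absurd h1 (ha.asymm hw2.ge))
    rw [Finset.sum_pair hpw, hp1, hw2] at h
    exact Finset.card_le_one.1 (Nat.le_of_add_le_add_right (b := 3) h) x (by simpa using hx) y
      (by simpa using hy)
  · intro z hz s hs u hu huz hout' x y hx hy
    obtain ⟨p, w, hpw, hpz, hp1, hw2, hpp, hww⟩ := hpre z hz
    have hup : u ≠ p := by
      rintro rfl
      exact hu hpp
    have huw : u ≠ w := by
      rintro rfl
      exact hu hww
    have h := ha.card_sibling_add_sum_le z {u, p, w} (by
      intro t ht y h1 h2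
      simp only [Finset.mem_insert, Finset.mem_singleton] at ht
      rcases ht with rfl | rfl | rfl
      · exact hout' y h2
      · exact hout _ hpp _ _ h2 h1
      · exact absurd h1 (ha.asymm hw2.ge))
    rw [Finset.sum_insert (by simp [hup, huw]), Finset.sum_pair hpw, hp1, hw2] at h
    have hpos : 0 < (Finset.univ.filter fun y =>
        Sibling (fun u v => 2 ≤ a u v) z y).card :=
      Finset.card_pos.2 ⟨s, by simpa using hs⟩
    have h3 := ha.add_eq_of_pos (u := u) (v := z) (by omega)
    have h4 := ha.card_sibling_add_sum_le u {z} (by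
      intro t ht y h1
      rw [Finset.mem_singleton] at ht
      subst ht
      exact absurd h1 (ha.asymm huz))
    rw [Finset.sum_singleton] at h4
    have h5 : a u z = 3 := by omega
    rw [h5] at h4
    exact Finset.card_le_one.1 (Nat.le_of_add_le_add_right (b := 3) h4) x (by simpa using hx) y
      (by simpa using hy)

end IsTokenAssignment

end Tokens

theorem exists_isSparseOrientation {V : Type*} [Fintype V] (G : SimpleGraph V)
    (hmad : ∀ A : Finset V, A.Nonempty → 3 * edgesIn G A ≤ 4 * A.card) :
    ∃ R, IsSparseOrientation G R := by
  obtain ⟨a, ha, hcyc⟩ := exists_isTokenAssignment_acyclic (exists_isTokenAssignment G hmad)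
  exact ⟨_, ha.isSparseOrientation hcyc⟩

section Rotation

/-- A fixed point free permutation `f` without 2-cycles, given with its inverse `g`, and a partial
matching `S` whose partners are given by `sib`. -/
structure IsMatchedRotation {ζ : Type*} (f g sib : ζ → ζ) (S : ζ → ζ → Prop) : Prop where
  apply_inv : ∀ x, f (g x) = x
  inv_apply : ∀ x, g (f x) = x
  apply_ne : ∀ x, f x ≠ x
  apply_apply_ne : ∀ x, f (f x) ≠ x
  symm : ∀ x y, S x y → S y x
  ne : ∀ x y, S x y → x ≠ y
  eq_sib : ∀ x y, S x y → y = sib x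

/-- The pairs which must receive distinct colors: points at distance at most two on a cycle of
`f`, unless the point between them is in `B`, and matched points. -/
def RotationConflict {ζ : Type*} (f : ζ → ζ) (S : ζ → ζ → Prop) (B : Set ζ) (x y : ζ) : Prop :=
  y = f x ∨ x = f y ∨ (y = f (f x) ∧ f x ∉ B) ∨ (x = f (f y) ∧ f y ∉ B) ∨ S x y

variable {ζ : Type*} {f g sib : ζ → ζ} {S : ζ → ζ → Prop} {W C : Finset ζ} {B : Set ζ}

theorem IsMatchedRotation.mem_of_apply_mem (h : IsMatchedRotation f g sib S)
    (hW : ∀ x ∈ W, f x ∈ W) {x : ζ} (hx : f x ∈ W) : x ∈ W := by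
  have h1 : W.image f = W := by
    refine Finset.eq_of_subset_of_card_le (Finset.image_subset_iff.2 hW) ?_
    rw [Finset.card_image_of_injective W (Function.LeftInverse.injective h.inv_apply)]
  rw [← h1] at hx
  obtain ⟨y, hy, hyx⟩ := Finset.mem_image.1 hx
  rwa [← h.inv_apply x, ← hyx, h.inv_apply]

theorem IsMatchedRotation.reverse (h : IsMatchedRotation f g sib S) :
    IsMatchedRotation g f sib S where
  apply_inv := h.inv_apply
  inv_apply := h.apply_inv
  apply_ne x hx := h.apply_ne x (by rw [← hx, h.apply_inv, hx])
  apply_apply_ne x hx := h.apply_apply_ne x (by rw [← hx, h.apply_inv, h.apply_inv, hx])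
  symm := h.symm
  ne := h.ne
  eq_sib := h.eq_sib

theorem IsMatchedRotation.conflict_symm (h : IsMatchedRotation f g sib S) {x y : ζ}
    (hxy : RotationConflict f S B x y) : RotationConflict f S B y x := by
  have := h.symm x y
  unfold RotationConflict at *
  tauto

theorem IsMatchedRotation.conflict_ne (h : IsMatchedRotation f g sib S) {x y : ζ}
    (hxy : RotationConflict f S B x y) : x ≠ y := by
  rintro rfl
  rcases hxy with h1 | h1 | h1 | h1 | h1
  · exact h.apply_ne x h1.symm
  · exact h.apply_ne x h1.symm
  · exact h.apply_apply_ne x h1.1.symm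
  · exact h.apply_apply_ne x h1.1.symm
  · exact h.ne x x h1 rfl

theorem IsMatchedRotation.conflict_cases (h : IsMatchedRotation f g sib S) {x y : ζ}
    (hxy : RotationConflict f S B x y) :
    y = f x ∨ y = g x ∨ (y = f (f x) ∧ f x ∉ B) ∨ (y = g (g x) ∧ g x ∉ B) ∨
      (y = sib x ∧ S x y) := by
  have := h.inv_apply
  have := h.eq_sib x y
  unfold RotationConflict at *
  grind

/-- Greedy extension of a coloring of an invariant set `W` to a disjoint invariant set `C`, on
which a subset `Q` first receives the color `γ`. -/
theorem IsMatchedRotation.extend (h : IsMatchedRotation f g sib S)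
    (hW : ∀ x ∈ W, f x ∈ W) (hC : ∀ x ∈ C, f x ∈ C) (hWC : Disjoint W C)
    (Q : Finset ζ) (hQC : Q ⊆ C) (c' : ζ → Fin 5) (γ : Fin 5)
    (hc' : ∀ x ∈ W, ∀ y ∈ W, RotationConflict f S B x y → c' x ≠ c' y)
    (hQ : ∀ x ∈ Q, ∀ y ∈ W, S x y → γ ≠ c' y)
    (hQQ : ∀ x ∈ Q, ∀ y ∈ Q, ¬RotationConflict f S B x y)
    (hX : ∀ X ⊆ C, Disjoint X Q → X.Nonempty → ∃ v ∈ X, ∃ T : Finset ζ, T.card ≤ 4 ∧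
      ∀ w, RotationConflict f S B v w → (w ∈ W ∨ w ∈ Q ∨ w ∈ X) →
        w ∈ T ∨ (w ∈ Q ∧ ∃ t ∈ T, t ∈ Q)) :
    ∃ c : ζ → Fin 5, (∀ x ∈ W, c x = c' x) ∧ (∀ x ∈ Q, c x = γ) ∧
      ∀ x ∈ W ∪ C, ∀ y ∈ W ∪ C, RotationConflict f S B x y → c x ≠ c y := by
  have key : ∀ X ⊆ C, Disjoint X Q → ∃ c : ζ → Fin 5, (∀ x ∈ W, c x = c' x) ∧
      (∀ x ∈ Q, c x = γ) ∧ ∀ x ∈ W ∪ Q ∪ X, ∀ y ∈ W ∪ Q ∪ X,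
        RotationConflict f S B x y → c x ≠ c y := by
    intro X
    induction X using Finset.strongInduction with
    | H X ih =>
    intro hXC hXQ
    rcases X.eq_empty_or_nonempty with rfl | hne
    · have hWQ : ∀ x ∈ W, x ∉ Q := fun x hx hxQ => Finset.disjoint_left.1 hWC hx (hQC hxQ)
      have hcross : ∀ x ∈ Q, ∀ y ∈ W, RotationConflict f S B x y → γ ≠ c' y := by
        intro x hx y hy hxy
        have hxC := hQC hx
        have hyC := Finset.disjoint_left.1 hWC hy
        rcases hxy with rfl | rfl | h1 | h1 | h1
        · exact absurd (hC _ hxC) hyC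
        · exact absurd hxC (Finset.disjoint_left.1 hWC (hW _ hy))
        · exact absurd (h1.1 ▸ hC _ (hC _ hxC)) hyC
        · exact absurd (h1.1 ▸ hxC) (Finset.disjoint_left.1 hWC (hW _ (hW _ hy)))
        · exact hQ x hx y hy h1
      refine ⟨fun x => if x ∈ Q then γ else c' x, fun x hx => if_neg (hWQ x hx),
        fun x hx => if_pos hx, ?_⟩
      intro x hx y hy hxy
      simp only [Finset.union_empty, Finset.mem_union] at hx hy
      have hyx := h.conflict_symm hxy
      grind
    · obtain ⟨v, hv, T, hT, hvT⟩ := hX X hXC hXQ hne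
      obtain ⟨c, hcW, hcQ, hc⟩ := ih (X.erase v) (Finset.erase_ssubset hv)
        ((Finset.erase_subset v X).trans hXC)
        (hXQ.mono_left (Finset.erase_subset v X))
      obtain ⟨k, hk⟩ : ∃ k, k ∉ T.image c := by
        by_contra! hall
        have h1 := Finset.card_le_card (fun k _ => hall k : Finset.univ ⊆ T.image c)
        have h2 := Finset.card_image_le (s := T) (f := c)
        rw [Finset.card_univ, Fintype.card_fin] at h1
        omega
      have hvW : v ∉ W := fun hvW => Finset.disjoint_left.1 hWC hvW (hXC hv)
      have hvQ : v ∉ Q := Finset.disjoint_left.1 hXQ hv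
      have hkey : ∀ y ∈ W ∪ Q ∪ X, RotationConflict f S B v y → k ≠ c y := by
        intro y hy hvy hky
        simp only [Finset.mem_union, or_assoc] at hy
        rcases hvT y hvy hy with h1 | ⟨h1, t, htT, htQ⟩
        · exact hk (hky ▸ Finset.mem_image_of_mem c h1)
        · rw [hcQ y h1, ← hcQ t htQ] at hky
          exact hk (hky ▸ Finset.mem_image_of_mem c htT)
      refine ⟨Function.update c v k, ?_, ?_, ?_⟩
      · intro x hx
        rw [Function.update_of_ne (by rintro rfl; exact hvW hx), hcW x hx]
      · intro x hx
        rw [Function.update_of_ne (by rintro rfl; exact hvQ hx), hcQ x hx]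
      · intro x hx y hy hxy
        have hne := h.conflict_ne hxy
        have hyx := h.conflict_symm hxy
        have hmem : ∀ z ∈ W ∪ Q ∪ X, z ≠ v → z ∈ W ∪ Q ∪ X.erase v := by
          intro z hz hzv
          simp only [Finset.mem_union, Finset.mem_erase] at hz ⊢
          tauto
        by_cases hxv : x = v
        · subst hxv
          rw [Function.update_self, Function.update_of_ne hne.symm]
          exact hkey y hy hxy
        · rw [Function.update_of_ne hxv]
          by_cases hyv : y = v
          · subst hyv
            rw [Function.update_self]
            exact (hkey x hx hyx).symm
          · rw [Function.update_of_ne hyv]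
            exact hc x (hmem x hx hxv) y (hmem y hy hyv) hxy
  obtain ⟨c, h1, h2, h3⟩ := key (C \ Q) Finset.sdiff_subset Finset.sdiff_disjoint
  refine ⟨c, h1, h2, ?_⟩
  rwa [Finset.union_assoc, Finset.union_sdiff_of_subset hQC] at h3

theorem IsMatchedRotation.exists_apply_notMem (hmin : ∀ X ⊆ C, X.Nonempty → (∀ x ∈ X, f x ∈ X) →
    X = C) {X : Finset ζ} (hXC : X ⊆ C) (hne : X.Nonempty) {m : ζ} (hm : m ∈ C) (hmX : m ∉ X) :
    ∃ v ∈ X, f v ∉ X := by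
  by_contra! hcl
  rw [hmin X hXC hne hcl] at hmX
  exact hmX hm

theorem IsMatchedRotation.disjoint_of_conflict (h : IsMatchedRotation f g sib S)
    (hC : ∀ x ∈ C, f x ∈ C) (hWC : Disjoint W C) {v : ζ} (hv : v ∈ C) :
    f v ∉ W ∧ f (f v) ∉ W ∧ g v ∉ W ∧ g (g v) ∉ W := by
  have hC' : ∀ x ∈ C, g x ∈ C := fun x hx =>
    h.mem_of_apply_mem hC (by rwa [h.apply_inv])
  have hd : ∀ x ∈ C, x ∉ W := fun x hx hxW => Finset.disjoint_left.1 hWC hxW hx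
  exact ⟨hd _ (hC _ hv), hd _ (hC _ (hC _ hv)), hd _ (hC' _ hv), hd _ (hC' _ (hC' _ hv))⟩

/-- Extension to a cycle `C` broken at `m`, where the color of `m` or of its successor is
repeated next to the partner of that successor. -/
theorem IsMatchedRotation.extend_break (h : IsMatchedRotation f g sib S)
    (hW : ∀ x ∈ W, f x ∈ W) (hC : ∀ x ∈ C, f x ∈ C) (hWC : Disjoint W C)
    (hmin : ∀ X ⊆ C, X.Nonempty → (∀ x ∈ X, f x ∈ X) → X = C)
    {m : ζ} (hm : m ∈ C) (hB : ∀ x ∈ C, x ∈ B ↔ x = m) (c' : ζ → Fin 5)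
    (hc' : ∀ x ∈ W, ∀ y ∈ W, RotationConflict f S B x y → c' x ≠ c' y)
    (hfull : ∀ z ∈ C, S z (sib z) ∧ sib z ∈ W ∪ C ∧
      [f z, f (f z), g z, g (g z), sib z].Nodup) :
    ∃ c : ζ → Fin 5, (∀ x ∈ W, c x = c' x) ∧
      (∀ x ∈ W ∪ C, ∀ y ∈ W ∪ C, RotationConflict f S B x y → c x ≠ c y) ∧
      (c m = c (sib (f m)) ∨ c m = c (f (sib (f m))) ∨ c (f m) = c (f (sib (f m)))) := by
  have hfg := h.apply_inv
  have hgf := h.inv_apply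
  have hC' : ∀ x ∈ C, g x ∈ C := fun x hx => h.mem_of_apply_mem hC (by rwa [hfg])
  have hd : ∀ x ∈ C, x ∉ W := fun x hx hxW => Finset.disjoint_left.1 hWC hxW hx
  have hcol : ∀ a b : Fin 5, a ≠ b → ∀ z, ∃ γ, (γ = a ∨ γ = b) ∧ ∀ y ∈ W, S z y → γ ≠ c' y := by
    intro a b hab z
    by_cases haz : a = c' (sib z)
    · exact ⟨b, Or.inr rfl, fun y _ hy hby =>
        hab (haz.trans ((h.eq_sib z y hy ▸ hby).symm))⟩
    · exact ⟨a, Or.inl rfl, fun y _ hy hay => haz (h.eq_sib z y hy ▸ hay)⟩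
  have hfm := hfull (f m) (hC m hm)
  obtain ⟨hS, hsmem, hnd⟩ := hfm
  have hSs := h.symm _ _ hS
  have hss := h.eq_sib _ _ hSs
  set s := sib (f m) with hs
  simp only [List.nodup_cons, List.mem_cons, List.not_mem_nil, or_false, not_or, hgf] at hnd
  have hne := h.ne
  have hne1 := h.apply_ne
  have hne2 := h.apply_apply_ne
  have hsymm := h.symm
  have heq := h.eq_sib
  rcases Finset.mem_union.1 hsmem with hsW | hsC
  · obtain ⟨γ, hγ, hγm⟩ := hcol (c' s) (c' (f s))
      (hc' s hsW (f s) (hW s hsW) (Or.inl rfl)) m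
    obtain ⟨c, h1, h2, h3⟩ := h.extend hW hC hWC {m} (by simpa using hm) c' γ hc'
      (by simpa using hγm)
      (by
        simp only [Finset.mem_singleton]
        rintro x rfl y rfl hxy
        exact h.conflict_ne hxy rfl)
      (by
        intro X hXC hXQ hX
        rw [Finset.disjoint_singleton_right] at hXQ
        obtain ⟨v, hv, hfv⟩ := IsMatchedRotation.exists_apply_notMem hmin hXC hX hm hXQ
        have hvd := h.disjoint_of_conflict hC hWC (hXC hv)
        refine ⟨v, hv, ?_⟩
        by_cases hvm : f v = m
        · refine ⟨{m, g v, g (g v), sib v}, Finset.card_le_four, fun w hvw hw => Or.inl ?_⟩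
          have := h.conflict_cases hvw
          simp only [Finset.mem_insert, Finset.mem_singleton]
          grind
        · refine ⟨{f (f v), g v, g (g v), sib v}, Finset.card_le_four, fun w hvw hw => Or.inl ?_⟩
          have := h.conflict_cases hvw
          simp only [Finset.mem_insert, Finset.mem_singleton] at hw ⊢
          grind)
    refine ⟨c, h1, h3, ?_⟩
    rw [h1 s hsW, h1 (f s) (hW s hsW), h2 m (Finset.mem_singleton_self m)]
    tauto
  · by_cases hsg : s = g (g m)
    · obtain ⟨γ, -, hγm⟩ := hcol 0 1 (by decide) (g m)
      obtain ⟨c, h1, h2, h3⟩ := h.extend hW hC hWC {f m, g m}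
        (by
          rw [Finset.insert_subset_iff, Finset.singleton_subset_iff]
          exact ⟨hC m hm, hC' m hm⟩) c' γ hc'
        (by
          simp only [Finset.mem_insert, Finset.mem_singleton]
          rintro x (rfl | rfl) y hy hxy
          · rw [h.eq_sib _ _ hxy] at hy
            exact absurd hy (hd s hsC)
          · exact hγm y hy hxy)
        (by
          have hmnd := (hfull m hm).2.2
          have := (hB m hm).2 rfl
          have h4 : ¬RotationConflict f S B (f m) (g m) := by
            intro hxy
            have := h.conflict_cases hxy
            simp only [List.nodup_cons, List.mem_cons, List.not_mem_nil, or_false, not_or] at hmnd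
            grind
          simp only [Finset.mem_insert, Finset.mem_singleton]
          rintro x (rfl | rfl) y (rfl | rfl) hxy
          · exact h.conflict_ne hxy rfl
          · exact h4 hxy
          · exact h4 (h.conflict_symm hxy)
          · exact h.conflict_ne hxy rfl)
        (by
          intro X hXC hXQ hX
          rw [Finset.disjoint_insert_right, Finset.disjoint_singleton_right] at hXQ
          obtain ⟨v, hv, hfv⟩ :=
            IsMatchedRotation.exists_apply_notMem hmin hXC hX (hC m hm) hXQ.1
          have hvd := h.disjoint_of_conflict hC hWC (hXC hv)
          refine ⟨v, hv, ?_⟩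
          by_cases hvm : v = m
          · subst hvm
            refine ⟨{f v, f (f v), g (g v), sib v}, Finset.card_le_four, fun w hvw hw => ?_⟩
            rcases h.conflict_cases hvw with rfl | rfl | ⟨rfl, -⟩ | ⟨rfl, -⟩ | ⟨rfl, -⟩
            · simp
            · exact Or.inr ⟨by simp, f v, by simp, by simp⟩
            · simp
            · simp
            · simp
          · by_cases hvm' : v = g (g m)
            · refine ⟨{f v, f (f v), g v, g (g v)}, Finset.card_le_four, fun w hvw hw => ?_⟩
              rcases h.conflict_cases hvw with rfl | rfl | ⟨rfl, -⟩ | ⟨rfl, -⟩ | ⟨rfl, -⟩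
              · simp
              · simp
              · simp
              · simp
              · refine Or.inr ⟨?_, f v, by simp, by simp [hvm', hfg]⟩
                rw [hvm', ← hsg, ← hss]
                simp
            · refine ⟨{f (f v), g v, g (g v), sib v}, Finset.card_le_four,
                fun w hvw hw => Or.inl ?_⟩
              have := h.conflict_cases hvw
              simp only [Finset.mem_insert, Finset.mem_singleton] at hw ⊢
              grind)
      refine ⟨c, h1, h3, Or.inr (Or.inr ?_)⟩
      rw [hsg, hfg, h2 (f m) (by simp), h2 (g m) (by simp)]
    · obtain ⟨γ, -, hγm⟩ := hcol 0 1 (by decide) m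
      obtain ⟨c, h1, h2, h3⟩ := h.extend hW hC hWC {m, s}
        (by
          rw [Finset.insert_subset_iff, Finset.singleton_subset_iff]
          exact ⟨hm, hsC⟩) c' γ hc'
        (by
          simp only [Finset.mem_insert, Finset.mem_singleton]
          rintro x (rfl | rfl) y hy hxy
          · exact hγm y hy hxy
          · rw [h.eq_sib _ _ hxy, ← hss] at hy
            exact absurd hy (hd _ (hC m hm)))
        (by
          have h4 : ¬RotationConflict f S B m s := by
            intro hxy
            have := h.conflict_cases hxy
            grind
          simp only [Finset.mem_insert, Finset.mem_singleton]
          rintro x (rfl | rfl) y (rfl | rfl) hxy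
          · exact h.conflict_ne hxy rfl
          · exact h4 hxy
          · exact h4 (h.conflict_symm hxy)
          · exact h.conflict_ne hxy rfl)
        (by
          intro X hXC hXQ hX
          rw [Finset.disjoint_insert_right, Finset.disjoint_singleton_right] at hXQ
          by_cases hcase : ∃ v ∈ X, f v ∉ X ∧ f v ≠ s
          · obtain ⟨v, hv, hfv, hfs⟩ := hcase
            have hvd := h.disjoint_of_conflict hC hWC (hXC hv)
            refine ⟨v, hv, ?_⟩
            by_cases hvm : f v = m
            · refine ⟨{m, g v, g (g v), sib v}, Finset.card_le_four, fun w hvw hw => Or.inl ?_⟩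
              have := h.conflict_cases hvw
              simp only [Finset.mem_insert, Finset.mem_singleton]
              grind
            · refine ⟨{f (f v), g v, g (g v), sib v}, Finset.card_le_four,
                fun w hvw hw => Or.inl ?_⟩
              have := h.conflict_cases hvw
              simp only [Finset.mem_insert, Finset.mem_singleton] at hw ⊢
              grind
          by_cases hcase' : ∃ v ∈ X, g v ∉ X ∧ g v ≠ s
          · obtain ⟨v, hv, hfv, hfs⟩ := hcase'
            have hvd := h.disjoint_of_conflict hC hWC (hXC hv)
            refine ⟨v, hv, ?_⟩
            by_cases hvm : g v = m
            · refine ⟨{m, f v, f (f v), sib v}, Finset.card_le_four, fun w hvw hw => Or.inl ?_⟩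
              have := h.conflict_cases hvw
              simp only [Finset.mem_insert, Finset.mem_singleton]
              grind
            · refine ⟨{g (g v), f v, f (f v), sib v}, Finset.card_le_four,
                fun w hvw hw => Or.inl ?_⟩
              have := h.conflict_cases hvw
              simp only [Finset.mem_insert, Finset.mem_singleton] at hw ⊢
              grind
          exfalso
          push Not at hcase hcase'
          by_cases hfs : f s ∈ X
          · have h5 := hmin (insert s X) (Finset.insert_subset hsC hXC)
              (Finset.insert_nonempty s X) (by
                intro x hx
                simp only [Finset.mem_insert] at hx ⊢
                grind)
            rw [← h5, Finset.mem_insert] at hm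
            grind
          · have h5 : ∀ x ∈ X, g x ∈ X := by
              intro x hx
              by_contra hgx
              have := hcase' x hx hgx
              grind
            have h6 := hmin X hXC hX fun x hx =>
              h.reverse.mem_of_apply_mem h5 (by rwa [hgf])
            rw [h6] at hXQ
            exact hXQ.1 hm)
      refine ⟨c, h1, h3, Or.inl ?_⟩
      rw [h2 m (by simp), h2 s (by simp)]

theorem IsMatchedRotation.extend_cycle (h : IsMatchedRotation f g sib S)
    (hW : ∀ x ∈ W, f x ∈ W) (hC : ∀ x ∈ C, f x ∈ C) (hWC : Disjoint W C)
    (hmin : ∀ X ⊆ C, X.Nonempty → (∀ x ∈ X, f x ∈ X) → X = C) (c' : ζ → Fin 5)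
    (hc' : ∀ x ∈ W, ∀ y ∈ W, RotationConflict f S B x y → c' x ≠ c' y) {z : ζ} (hz : z ∈ C)
    (hfull : ¬(S z (sib z) ∧ sib z ∈ W ∪ C ∧ [f z, f (f z), g z, g (g z), sib z].Nodup)) :
    ∃ c : ζ → Fin 5, (∀ x ∈ W, c x = c' x) ∧
      ∀ x ∈ W ∪ C, ∀ y ∈ W ∪ C, RotationConflict f S B x y → c x ≠ c y := by
  obtain ⟨c, h1, -, h3⟩ := h.extend hW hC hWC ∅ (Finset.empty_subset C) c' 0 hc' (by simp)
    (by simp) (by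
      intro X hXC _ hX
      simp only [Finset.notMem_empty, false_and, or_false, false_or]
      by_cases hcase : ∃ v ∈ X, f v ∉ X
      · obtain ⟨v, hv, hfv⟩ := hcase
        have hvd := h.disjoint_of_conflict hC hWC (hXC hv)
        refine ⟨v, hv, {f (f v), g v, g (g v), sib v}, Finset.card_le_four, fun w hvw hw => ?_⟩
        rcases h.conflict_cases hvw with rfl | rfl | ⟨rfl, -⟩ | ⟨rfl, -⟩ | ⟨rfl, -⟩
        · exact absurd hw (not_or.2 ⟨hvd.1, hfv⟩)
        all_goals simp
      push Not at hcase
      obtain rfl := hmin X hXC hX hcase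
      by_cases hs : S z (sib z) ∧ sib z ∈ W ∪ X
      · refine ⟨z, hz, [f z, f (f z), g z, g (g z), sib z].toFinset, ?_, fun w hzw _ => ?_⟩
        · have hnd : ¬[f z, f (f z), g z, g (g z), sib z].Nodup := fun hnd =>
            hfull ⟨hs.1, hs.2, hnd⟩
          have h4 := List.toFinset_card_le [f z, f (f z), g z, g (g z), sib z]
          have h5 : [f z, f (f z), g z, g (g z), sib z].toFinset.card ≠ 5 := fun h5 =>
            hnd (Multiset.toFinset_card_eq_card_iff_nodup.1 h5)
          simp only [List.length_cons, List.length_nil] at h4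
          omega
        · have := h.conflict_cases hzw
          simp only [List.mem_toFinset, List.mem_cons]
          tauto
      · refine ⟨z, hz, {f z, f (f z), g z, g (g z)}, Finset.card_le_four, fun w hzw hw => ?_⟩
        rcases h.conflict_cases hzw with rfl | rfl | ⟨rfl, -⟩ | ⟨rfl, -⟩ | ⟨rfl, h5⟩
        · simp
        · simp
        · simp
        · simp
        · exact absurd ⟨h5, Finset.mem_union.2 hw⟩ hs)
  exact ⟨c, h1, h3⟩

theorem Finset.card_insert_le_four {α : Type*} [DecidableEq α] {p q r s t : α}
    (h : q = s ∨ q = t ∨ p = t) :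
    ({p, q, r, s, t} : Finset α).card ≤ 4 := by
  have h4 : ∀ x y z w : α, ({x, y, z, w} : Finset α).card ≤ 4 := fun x y z w =>
    Finset.card_le_four
  rcases h with rfl | rfl | rfl
  · refine (Finset.card_le_card ?_).trans (h4 p q r t)
    intro x
    simp only [Finset.mem_insert, Finset.mem_singleton]
    tauto
  · refine (Finset.card_le_card ?_).trans (h4 p q r s)
    intro x
    simp only [Finset.mem_insert, Finset.mem_singleton]
    tauto
  · refine (Finset.card_le_card ?_).trans (h4 p q r s)
    intro x
    simp only [Finset.mem_insert, Finset.mem_singleton]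
    tauto

theorem IsMatchedRotation.exists_coloring (h : IsMatchedRotation f g sib S) (W : Finset ζ)
    (hW : ∀ x ∈ W, f x ∈ W) :
    ∃ (c : ζ → Fin 5) (B : Set ζ), B ⊆ W ∧
      (∀ x ∈ W, ∀ y ∈ W, RotationConflict f S B x y → c x ≠ c y) ∧
      ∀ m ∈ B, f m ∉ B ∧ ∃ s ∈ W, S (f m) s ∧ g s ∉ B ∧
        ({c (f m), c m, c (f (f m)), c s, c (f s)} : Finset (Fin 5)).card ≤ 4 := by
  induction W using Finset.strongInduction with
  | H W ih =>
  rcases W.eq_empty_or_nonempty with rfl | hne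
  · exact ⟨fun _ => 0, ∅, by simp⟩
  obtain ⟨C, ⟨hCne, hCW, hC⟩, hmin⟩ := WellFounded.has_min (measure Finset.card).wf
    {X : Finset ζ | X.Nonempty ∧ X ⊆ W ∧ ∀ x ∈ X, f x ∈ X} ⟨W, hne, subset_rfl, hW⟩
  replace hmin : ∀ X ⊆ C, X.Nonempty → (∀ x ∈ X, f x ∈ X) → X = C := fun X hXC hX hfX =>
    Finset.eq_of_subset_of_card_le hXC (not_lt.1 (hmin X ⟨hX, hXC.trans hCW, hfX⟩))
  have hW' : ∀ x ∈ W \ C, f x ∈ W \ C := fun x hx => by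
    rw [Finset.mem_sdiff] at hx ⊢
    exact ⟨hW x hx.1, fun hfx => hx.2 (h.mem_of_apply_mem hC hfx)⟩
  have hWC : Disjoint (W \ C) C := Finset.sdiff_disjoint
  have hunion : W \ C ∪ C = W := Finset.sdiff_union_of_subset hCW
  obtain ⟨c', B, hBW, hc', hB⟩ := ih (W \ C) (Finset.sdiff_ssubset hCW hCne) hW'
  have hold : ∀ c : ζ → Fin 5, (∀ x ∈ W \ C, c x = c' x) → ∀ m ∈ B, f m ∈ W \ C ∧
      f m ∉ B ∧ ∃ s ∈ W \ C, S (f m) s ∧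
      g s ∈ W \ C ∧ g s ∉ B ∧
        ({c (f m), c m, c (f (f m)), c s, c (f s)} : Finset (Fin 5)).card ≤ 4 := by
    intro c hc m hm
    obtain ⟨hfm, s, hs, hS, hgs, hcard⟩ := hB m hm
    have hmW := hBW hm
    refine ⟨hW' m hmW, hfm, s, hs, hS, h.mem_of_apply_mem hW' (by rwa [h.apply_inv]), hgs, ?_⟩
    rwa [hc _ hmW, hc _ (hW' _ hmW), hc _ (hW' _ (hW' _ hmW)), hc _ hs, hc _ (hW' _ hs)]
  by_cases hfull : ∀ z ∈ C, S z (sib z) ∧ sib z ∈ W \ C ∪ C ∧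
      [f z, f (f z), g z, g (g z), sib z].Nodup
  · obtain ⟨m, hm⟩ := hCne
    have hmW : m ∉ W \ C := fun h' => (Finset.mem_sdiff.1 h').2 hm
    have hBC : ∀ x ∈ C, x ∉ B := fun x hx hxB => (Finset.mem_sdiff.1 (hBW hxB)).2 hx
    have hconf : ∀ x ∈ W \ C, ∀ y ∈ W \ C, RotationConflict f S (insert m B) x y →
        c' x ≠ c' y := by
      intro x hx y hy hxy
      refine hc' x hx y hy ?_
      unfold RotationConflict at hxy ⊢
      simp only [Set.mem_insert_iff, not_or] at hxy
      tauto
    obtain ⟨c, h1, h2, h3⟩ := h.extend_break hW' hC hWC hmin hm (B := insert m B)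
      (fun x hx => by
        rw [Set.mem_insert_iff]
        exact or_iff_left (hBC x hx)) c' hconf hfull
    rw [hunion] at h2
    refine ⟨c, insert m B, ?_, h2, ?_⟩
    · exact Set.insert_subset (hCW hm) fun x hx => (Finset.mem_sdiff.1 (hBW hx)).1
    · rintro x (rfl | hx)
      · obtain ⟨hS, hsW, -⟩ := hfull (f x) (hC x hm)
        rw [hunion] at hsW
        refine ⟨?_, _, hsW, hS, ?_, Finset.card_insert_le_four h3⟩
        · rintro (h4 | h4)
          · exact h.apply_ne x h4
          · exact hBC _ (hC x hm) h4
        rintro (h4 | h4)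
        · refine h.ne _ _ hS ?_
          rw [← h.apply_inv (sib (f x)), h4]
        · obtain ⟨-, t, ht, hSt, -⟩ := hB _ h4
          rw [h.apply_inv] at hSt
          have h5 := h.eq_sib _ _ hSt
          rw [← h.eq_sib _ _ (h.symm _ _ hS)] at h5
          rw [h5] at ht
          exact (Finset.mem_sdiff.1 ht).2 (hC x hm)
      · obtain ⟨hfxW, hfx, s, hs, hS, hgsW, hgs, hcard⟩ := hold c h1 x hx
        refine ⟨?_, s, (Finset.mem_sdiff.1 hs).1, hS, ?_, hcard⟩
        · rintro (h4 | h4)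
          · rw [h4] at hfxW
            exact hmW hfxW
          · exact hfx h4
        rintro (h4 | h4)
        · rw [h4] at hgsW
          exact hmW hgsW
        · exact hgs h4
  · push Not at hfull
    obtain ⟨z, hz, hz'⟩ := hfull
    obtain ⟨c, h1, h2⟩ := h.extend_cycle hW' hC hWC hmin c' hc' hz
      (fun h' => hz' h'.1 h'.2.1 h'.2.2)
    rw [hunion] at h2
    refine ⟨c, B, fun x hx => (Finset.mem_sdiff.1 (hBW hx)).1, h2, fun m hm => ?_⟩
    obtain ⟨-, hfm, s, hs, hS, -, hgs, hcard⟩ := hold c h1 m hm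
    exact ⟨hfm, s, (Finset.mem_sdiff.1 hs).1, hS, hgs, hcard⟩

end Rotation

/-- A coloring of the vertices on directed cycles, with a set `B` of vertices behind whose
successor the condition at distance two is dropped. -/
structure IsCyclicColoring {V : Type*} (R : V → V → Prop) (c : V → Fin 5) (B : Set V) :
    Prop where
  cyclic : ∀ m ∈ B, Relation.TransGen R m m
  notMem : ∀ m ∈ B, ∀ x, R m x → x ∉ B
  ne_out : ∀ x y, Relation.TransGen R x x → R x y → c x ≠ c y
  ne_out_out : ∀ x y z, Relation.TransGen R x x → R x y → R y z → y ∉ B → c x ≠ c z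
  ne_sibling : ∀ x y, Relation.TransGen R x x → Relation.TransGen R y y → Sibling R x y →
    c x ≠ c y
  exists_sibling : ∀ m ∈ B, ∀ x y, R m x → R x y → ∃ s t, Relation.TransGen R s s ∧
    Sibling R x s ∧ R s t ∧ (∀ p ∈ B, ¬R p s) ∧
      ({c x, c m, c y, c s, c t} : Finset (Fin 5)).card ≤ 4

section Orientation

variable {V : Type*} [Fintype V] {G : SimpleGraph V} {R : V → V → Prop}

namespace IsSparseOrientation

theorem transGen_of_cyclic (h : IsSparseOrientation G R) {z w : V}
    (hz : Relation.TransGen R z z) (hzw : R z w) : Relation.TransGen R w w := by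
  obtain ⟨w', hzw', hwz⟩ := Relation.TransGen.head'_iff.1 hz
  obtain rfl := h.cyclic_out z hz _ _ hzw hzw'
  exact Relation.TransGen.tail' hwz hzw

theorem exists_isMatchedRotation (h : IsSparseOrientation G R) :
    ∃ f g sib : {v // Relation.TransGen R v v} → {v // Relation.TransGen R v v},
      (∀ z, R z.1 (f z).1) ∧ IsMatchedRotation f g sib fun x y => Sibling R x.1 y.1 := by
  have hex : ∀ z : {v // Relation.TransGen R v v}, ∃ w : {v // Relation.TransGen R v v},
      R z.1 w.1 := by
    rintro ⟨z, hz⟩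
    obtain ⟨w, hzw, -⟩ := Relation.TransGen.head'_iff.1 hz
    exact ⟨⟨w, h.transGen_of_cyclic hz hzw⟩, hzw⟩
  choose f hf using hex
  have hsurj : Function.Surjective f := by
    rintro ⟨z, hz⟩
    obtain ⟨p, hzp, hpz⟩ := Relation.TransGen.tail'_iff.1 hz
    have hp : Relation.TransGen R p p := Relation.TransGen.head' hpz hzp
    exact ⟨⟨p, hp⟩, Subtype.ext (h.cyclic_out p hp _ _ (hf ⟨p, hp⟩) hpz)⟩
  let e := Equiv.ofBijective f ⟨Finite.injective_iff_surjective.2 hsurj, hsurj⟩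
  refine ⟨f, e.symm, fun x => if hx : ∃ y : {v // Relation.TransGen R v v},
    Sibling R x.1 y.1 then hx.choose else x, hf, ?_⟩
  refine ⟨e.apply_symm_apply, e.symm_apply_apply, ?_, ?_, fun _ _ hxy => hxy.symm, ?_, ?_⟩
  · intro x hx
    have := hf x
    rw [hx] at this
    exact h.asymm _ _ this this
  · intro x hx
    have := hf (f x)
    rw [hx] at this
    exact h.asymm _ _ (hf x) this
  · rintro x y hxy rfl
    exact hxy.1 rfl
  · intro x y hxy
    have hx : ∃ y : {v // Relation.TransGen R v v}, Sibling R x.1 y.1 := ⟨y, hxy⟩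
    rw [dif_pos hx]
    exact Subtype.ext (h.cyclic_sibling x.1 x.2 _ _ hxy hx.choose_spec)

theorem exists_isCyclicColoring (h : IsSparseOrientation G R) :
    ∃ c B, IsCyclicColoring R c B := by
  obtain ⟨f, g, sib, hf, hrot⟩ := h.exists_isMatchedRotation
  obtain ⟨c, B, -, hc, hB⟩ := hrot.exists_coloring Finset.univ (by simp)
  replace hc := fun x y => hc x (Finset.mem_univ x) y (Finset.mem_univ y)
  have hfeq : ∀ (x : {v // Relation.TransGen R v v}) y, R x.1 y → y = (f x).1 := fun x y hxy =>
    h.cyclic_out x.1 x.2 _ _ hxy (hf x)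
  let c' : V → Fin 5 := fun v => if hv : Relation.TransGen R v v then c ⟨v, hv⟩ else 0
  have hc' : ∀ x : {v // Relation.TransGen R v v}, c' x.1 = c x := fun x => dif_pos x.2
  have hmem : ∀ x : {v // Relation.TransGen R v v}, x.1 ∈ Subtype.val '' B → x ∈ B := by
    rintro x ⟨y, hy, hyx⟩
    rwa [← Subtype.ext hyx]
  refine ⟨c', Subtype.val '' B, ?_, ?_, ?_, ?_, ?_, ?_⟩
  · rintro - ⟨m, -, rfl⟩
    exact m.2
  · rintro - ⟨m, hm, rfl⟩ x hmx hx
    rw [hfeq m x hmx] at hx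
    exact (hB m hm).1 (hmem _ hx)
  · intro x y hx hxy
    rw [hfeq ⟨x, hx⟩ y hxy, hc' ⟨x, hx⟩, hc']
    exact hc _ _ (Or.inl rfl)
  · intro x y z hx hxy hyz hy
    obtain rfl := hfeq ⟨x, hx⟩ y hxy
    rw [hfeq (f ⟨x, hx⟩) z hyz, hc' ⟨x, hx⟩, hc']
    exact hc _ _ (Or.inr (Or.inr (Or.inl ⟨rfl, fun h' => hy ⟨_, h', rfl⟩⟩)))
  · intro x y hx hy hxy
    rw [hc' ⟨x, hx⟩, hc' ⟨y, hy⟩]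
    exact hc _ _ (Or.inr (Or.inr (Or.inr (Or.inr hxy))))
  · rintro - ⟨m, hm, rfl⟩ x y hmx hxy
    obtain rfl := hfeq m x hmx
    obtain rfl := hfeq (f m) y hxy
    obtain ⟨-, s, -, hS, hgs, hcard⟩ := hB m hm
    refine ⟨s.1, (f s).1, s.2, hS, hf s, ?_, ?_⟩
    · rintro - ⟨p, hp, rfl⟩ hps
      apply hgs
      rwa [Subtype.ext (hfeq p s.1 hps), hrot.inv_apply]
    · simpa only [hc'] using hcard

theorem eq_of_cyclic (h : IsSparseOrientation G R) {x y z : V} (hx : Relation.TransGen R x x)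
    (hy : Relation.TransGen R y y) (hxz : R x z) (hyz : R y z) : x = y := by
  obtain ⟨f, g, sib, hf, hrot⟩ := h.exists_isMatchedRotation
  have hfx : (f ⟨x, hx⟩).1 = z := h.cyclic_out x hx _ _ (hf ⟨x, hx⟩) hxz
  have hfy : (f ⟨y, hy⟩).1 = z := h.cyclic_out y hy _ _ (hf ⟨y, hy⟩) hyz
  have := (Function.LeftInverse.injective hrot.inv_apply)
    (Subtype.ext (hfx.trans hfy.symm) : f ⟨x, hx⟩ = f ⟨y, hy⟩)
  exact congrArg Subtype.val this

end IsSparseOrientation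

/-- The vertices `w` whose color has to be avoided by `v`. -/
def Avoids (R : V → V → Prop) (B : Set V) (v w : V) : Prop :=
  (R v w ∨ (∃ x, R v x ∧ R x w) ∨ Sibling R v w) ∨ (w ∈ B ∧ ∃ x, R w x ∧ R v x)

namespace IsCyclicColoring

variable {c₀ c : V → Fin 5} {B : Set V}

theorem card_image_avoids_le (hc : IsCyclicColoring R c₀ B) (h : IsSparseOrientation G R)
    (heq : ∀ z, Relation.TransGen R z z → c z = c₀ z) {v : V} (hv : ¬Relation.TransGen R v v) :
    ((Finset.univ.filter (Avoids R B v)).image c).card ≤ 4 := by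
  by_cases hm : ∃ m ∈ B, ∃ x, R m x ∧ R v x
  · obtain ⟨m, hm, x, hmx, hvx⟩ := hm
    have hmZ := hc.cyclic m hm
    have hxZ := h.transGen_of_cyclic hmZ hmx
    obtain ⟨x', hxx', -⟩ := Relation.TransGen.head'_iff.1 hxZ
    obtain ⟨s, t, hsZ, hxs, hst, hBs, hcard⟩ := hc.exists_sibling m hm x x' hmx hxx'
    by_cases hy : ∃ y, y ≠ x ∧ R v y
    · obtain ⟨y, hyx, hvy⟩ := hy
      obtain rfl := h.cyclic_sibling x hxZ _ _ hxs ⟨hyx.symm, v, hvx, hvy⟩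
      have hsub : Finset.univ.filter (Avoids R B v) ⊆ {x, m, x', s, t} := by
        intro w hw
        simp only [Finset.mem_filter, Finset.mem_univ, true_and] at hw
        simp only [Finset.mem_insert, Finset.mem_singleton]
        rcases hw with (hw | ⟨y, hvy', hyw⟩ | hw) | ⟨hwB, y, hwy, hvy'⟩
        · rcases h.eq_or_eq v x s hvx hvy hyx.symm w hw with rfl | rfl <;> simp
        · rcases h.eq_or_eq v x s hvx hvy hyx.symm y hvy' with rfl | rfl
          · simp [h.cyclic_out y hxZ w x' hyw hxx']
          · simp [h.cyclic_out y hsZ w t hyw hst]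
        · exact absurd hw (h.not_sibling v x s hvx hvy hyx.symm w)
        · rcases h.eq_or_eq v x s hvx hvy hyx.symm y hvy' with rfl | rfl
          · simp [h.eq_of_cyclic (hc.cyclic w hwB) hmZ hwy hmx]
          · exact absurd hwy (hBs w hwB)
      refine (Finset.card_le_card (Finset.image_subset_image hsub)).trans ?_
      simpa [Finset.image_insert, heq _ hxZ, heq _ hmZ, heq _ hsZ,
        heq _ (h.transGen_of_cyclic hxZ hxx'), heq _ (h.transGen_of_cyclic hsZ hst)] using hcard
    · push Not at hy
      have hout : ∀ w, R v w → w = x := fun w hw => by_contra fun hne => hy w hne hw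
      have hsub : Finset.univ.filter (Avoids R B v) ⊆
          {x, x', m} ∪ Finset.univ.filter (Sibling R v) := by
        intro w hw
        simp only [Finset.mem_filter, Finset.mem_univ, true_and] at hw
        simp only [Finset.mem_union, Finset.mem_insert, Finset.mem_singleton, Finset.mem_filter,
          Finset.mem_univ, true_and]
        rcases hw with (hw | ⟨y, hvy, hyw⟩ | hw) | ⟨hwB, y, hwy, hvy⟩
        · simp [hout w hw]
        · obtain rfl := hout y hvy
          simp [h.cyclic_out y hxZ w x' hyw hxx']
        · exact Or.inr hw
        · obtain rfl := hout y hvy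
          simp [h.eq_of_cyclic (hc.cyclic w hwB) hmZ hwy hmx]
      have hsib : (Finset.univ.filter (Sibling R v)).card ≤ 1 := by
        refine Finset.card_le_one.2 fun a ha b hb => ?_
        exact h.sibling_of_cyclic x hxZ s hxs v hv hvx hout a b (Finset.mem_filter.1 ha).2
          (Finset.mem_filter.1 hb).2
      calc _ ≤ _ := Finset.card_image_le
        _ ≤ _ := Finset.card_le_card hsub
        _ ≤ _ := Finset.card_union_le _ _
        _ ≤ 3 + 1 := Nat.add_le_add Finset.card_le_three hsib
  · refine Finset.card_image_le.trans ((Finset.card_le_card ?_).trans (h.card_conflictSet_le v))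
    intro w hw
    simp only [Finset.mem_filter, Finset.mem_univ, true_and, conflictSet] at hw ⊢
    exact hw.resolve_right fun ⟨hwB, x, hwx, hvx⟩ => hm ⟨w, hwB, x, hwx, hvx⟩

theorem exists_extension (hc : IsCyclicColoring R c₀ B) (h : IsSparseOrientation G R)
    (X : Finset V) (hZ : ∀ z, Relation.TransGen R z z → z ∈ X)
    (hX : ∀ x ∈ X, ∀ y, R x y → y ∈ X) :
    ∃ c : V → Fin 5, (∀ z, Relation.TransGen R z z → c z = c₀ z) ∧
      ∀ u ∈ X, ¬Relation.TransGen R u u → ∀ w ∈ X, Avoids R B u w → c u ≠ c w := by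
  induction X using Finset.strongInduction with
  | H X ih =>
  by_cases hne : ∃ v ∈ X, ¬Relation.TransGen R v v
  · have htrans : IsTrans V fun u v => Relation.TransGen R u v ∧ ¬Relation.TransGen R u u :=
      ⟨fun _ _ _ huv hvw => ⟨huv.1.trans hvw.1, huv.2⟩⟩
    have hirr : Std.Irrefl fun u v => Relation.TransGen R u v ∧ ¬Relation.TransGen R u u :=
      ⟨fun _ hu => hu.2 hu.1⟩
    obtain ⟨v, ⟨hvX, hv⟩, hmin⟩ := (Finite.wellFounded_of_trans_of_irrefl
      fun u v => Relation.TransGen R u v ∧ ¬Relation.TransGen R u u).has_min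
        {v | v ∈ X ∧ ¬Relation.TransGen R v v} hne
    have hin : ∀ u ∈ X, ¬R u v := by
      intro u huX huv
      by_cases hu : Relation.TransGen R u u
      · exact hv (h.transGen_of_cyclic hu huv)
      · exact hmin u ⟨huX, hu⟩ ⟨.single huv, hu⟩
    obtain ⟨c, hcZ, hcX⟩ := ih (X.erase v) (Finset.erase_ssubset hvX)
      (fun z hz => Finset.mem_erase.2 ⟨by rintro rfl; exact hv hz, hZ z hz⟩)
      (fun x hx y hxy => Finset.mem_erase.2
        ⟨fun hyv => hin x (Finset.mem_of_mem_erase hx) (hyv ▸ hxy),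
          hX x (Finset.mem_of_mem_erase hx) y hxy⟩)
    obtain ⟨k, hk⟩ : ∃ k, k ∉ (Finset.univ.filter (Avoids R B v)).image c := by
      by_contra! hall
      have := hc.card_image_avoids_le h hcZ hv
      rw [Finset.eq_univ_of_forall hall] at this
      simp at this
    have hkw : ∀ w, Avoids R B v w → k ≠ c w := by
      rintro w hw rfl
      exact hk (Finset.mem_image_of_mem c (by simpa using hw))
    refine ⟨Function.update c v k, ?_, ?_⟩
    · intro z hz
      have hzv : z ≠ v := by rintro rfl; exact hv hz
      rw [Function.update_of_ne hzv, hcZ z hz]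
    · intro u huX hu w hwX huw
      by_cases huv : u = v
      · subst huv
        have hwu : w ≠ u := by
          rintro rfl
          rcases huw with (hw | ⟨y, hvy, hyw⟩ | hw) | ⟨hwB, -⟩
          · exact hu (.single hw)
          · exact hu (.head hvy (.single hyw))
          · exact hw.1 rfl
          · exact hu (hc.cyclic _ hwB)
        rw [Function.update_self, Function.update_of_ne hwu]
        exact hkw w huw
      · by_cases hwv : w = v
        · subst hwv
          rw [Function.update_self, Function.update_of_ne huv]
          rcases huw with (hw | ⟨y, hvy, hyw⟩ | hw) | ⟨hwB, -⟩
          · exact absurd hw (hin u huX)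
          · exact absurd hyw (hin y (hX u huX y hvy))
          · exact (hkw u (Or.inl (Or.inr (Or.inr hw.symm)))).symm
          · exact absurd (hc.cyclic _ hwB) hv
        · rw [Function.update_of_ne hwv, Function.update_of_ne huv]
          exact hcX u (Finset.mem_erase.2 ⟨huv, huX⟩) hu w (Finset.mem_erase.2 ⟨hwv, hwX⟩) huw
  · push Not at hne
    exact ⟨c₀, fun _ _ => rfl, fun u huX hu => absurd (hne u huX) hu⟩

theorem exists_isStarColoring (hc : IsCyclicColoring R c₀ B) (h : IsSparseOrientation G R) :
    ∃ c : V → Fin 5, IsStarColoring G c := by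
  obtain ⟨c, hcZ, hcN⟩ := hc.exists_extension h Finset.univ (by simp) (by simp)
  replace hcN := fun u hu w => hcN u (Finset.mem_univ u) hu w (Finset.mem_univ w)
  have hout : ∀ x y, R x y → c x ≠ c y := by
    intro x y hxy
    by_cases hx : Relation.TransGen R x x
    · rw [hcZ x hx, hcZ y (h.transGen_of_cyclic hx hxy)]
      exact hc.ne_out x y hx hxy
    · exact hcN x hx y (Or.inl (Or.inl hxy))
  have hout2 : ∀ x y z, R x y → R y z → y ∉ B → c x ≠ c z := by
    intro x y z hxy hyz hy
    by_cases hx : Relation.TransGen R x x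
    · have hyZ := h.transGen_of_cyclic hx hxy
      rw [hcZ x hx, hcZ z (h.transGen_of_cyclic hyZ hyz)]
      exact hc.ne_out_out x y z hx hxy hyz hy
    · exact hcN x hx z (Or.inl (Or.inr (Or.inl ⟨y, hxy, hyz⟩)))
  have hsib : ∀ x y, Sibling R x y → c x ≠ c y := by
    intro x y hxy
    by_cases hx : Relation.TransGen R x x
    · by_cases hy : Relation.TransGen R y y
      · rw [hcZ x hx, hcZ y hy]
        exact hc.ne_sibling x y hx hy hxy
      · exact (hcN y hy x (Or.inl (Or.inr (Or.inr hxy.symm)))).symm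
    · exact hcN x hx y (Or.inl (Or.inr (Or.inr hxy)))
  have hin : ∀ m ∈ B, ∀ u x, R m x → R u x → u ≠ m → c u ≠ c m := by
    intro m hm u x hmx hux hne
    by_cases hu : Relation.TransGen R u u
    · exact absurd (h.eq_of_cyclic hu (hc.cyclic m hm) hux hmx) hne
    · exact hcN u hu m (Or.inr ⟨hm, x, hmx, hux⟩)
  have hstar : ∀ u v w, ((R v w ∧ v ∉ B) ∨ (w ∈ B ∧ R w v)) → G.Adj u v → u ≠ w →
      c u ≠ c w := by
    rintro u v w (⟨hvw, hv⟩ | ⟨hw, hwv⟩) huv hne <;> rcases (h.adj_iff u v).1 huv with huv | hvu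
    · exact hout2 u v w huv hvw hv
    · exact hsib u w ⟨hne, v, hvu, hvw⟩
    · exact hin w hw u v hwv huv hne
    · exact (hout2 w v u hwv hvu (hc.notMem w hw v hwv)).symm
  refine ⟨c, fun u v huv => ?_, fun u v w x _ huw _ _ hvx _ huv hvw hwx ⟨h₁, h₂⟩ => ?_⟩
  · rcases (h.adj_iff u v).1 huv with huv | hvu
    · exact hout u v huv
    · exact (hout v u hvu).symm
  · have : ((R v w ∧ v ∉ B) ∨ (w ∈ B ∧ R w v)) ∨ ((R w v ∧ w ∉ B) ∨ (v ∈ B ∧ R v w)) := by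
      have := (h.adj_iff v w).1 hvw
      tauto
    rcases this with hvw | hwv
    · exact hstar u v w hvw huv huw h₁
    · exact hstar x w v hwv hwx.symm hvx.symm h₂.symm

end IsCyclicColoring

end Orientation

/-- If a finite simple graph has maximum average degree at most 8/3 (every nonempty
vertex subset `A` spans at most `4|A|/3` edges), then it admits a star 5-coloring. -/
theorem star_five_colorable_of_mad_le_eight_thirds {V : Type*} [Fintype V]
    (G : SimpleGraph V)
    (hmad : ∀ A : Finset V, A.Nonempty → 3 * edgesIn G A ≤ 4 * A.card) :
    ∃ c : V → Fin 5, IsStarColoring G c := by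
  obtain ⟨R, hR⟩ := exists_isSparseOrientation G hmad
  obtain ⟨c, B, hc⟩ := hR.exists_isCyclicColoring
  exact hc.exists_isStarColoring hR
end

section
/- If a finite simple graph G has an FII-partition F ⊔ Iα ⊔ Iβ, then G admits a star 5-coloring (a proper coloring with 5 colors in which no path on four vertices receives only two colors). -/
open scoped Classical

/-- `S` is a *2-independent set* of `G`: any two distinct vertices of `S` are at
distance at least 3 in `G`, i.e. they are non-adjacent and have no common neighbor. -/
def TwoIndepSet {W : Type*} (G : SimpleGraph W) (S : Set W) : Prop :=
  ∀ u ∈ S, ∀ v ∈ S, u ≠ v → ¬G.Adj u v ∧ ∀ w, ¬(G.Adj u w ∧ G.Adj w v)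

/-- `F ⊔ A ⊔ B` is an *FII-partition* of `G`: the three sets partition the vertex set,
the subgraph induced on `F` is a forest (acyclic), and `A`, `B` are 2-independent sets. -/
def IsFIIPartition {W : Type*} (G : SimpleGraph W) (F A B : Set W) : Prop :=
  (∀ v, v ∈ F ∨ v ∈ A ∨ v ∈ B) ∧
    Disjoint F A ∧ Disjoint F B ∧ Disjoint A B ∧
    (G.induce F).IsAcyclic ∧ TwoIndepSet G A ∧ TwoIndepSet G B

/-- `G` admits some FII-partition. -/
def HasFIIPartition {W : Type*} (G : SimpleGraph W) : Prop :=
  ∃ F A B, IsFIIPartition G F A B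

/-- In an acyclic graph, two paths from a common root to adjacent vertices differ exactly by the
edge joining their ends. -/
theorem SimpleGraph.IsAcyclic.length_penultimate_of_adj {W : Type*} {G : SimpleGraph W}
    (hG : G.IsAcyclic) {a b u v : W} (hab : a = b) (h : G.Adj u v) {p : G.Walk a u}
    {q : G.Walk b v} (hp : p.IsPath) (hq : q.IsPath) :
    (q.length = p.length + 1 ∧ q.penultimate = u) ∨
      (p.length = q.length + 1 ∧ p.penultimate = v) := by
  subst hab
  by_cases hv : v ∈ p.support
  · right
    have := hG.path_concat hq hp h.symm hv
    simp [this]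
  · left
    have : q = p.concat h :=
      congrArg Subtype.val ((hG.subsingleton_path a v).elim ⟨q, hq⟩ ⟨p.concat h, hp.concat hv h⟩)
    simp [this]

/-- The vertices of a forest can be given depths and parents so that each edge joins a vertex to
its parent, one level up. -/
theorem SimpleGraph.IsAcyclic.exists_depth_parent {W : Type*} {G : SimpleGraph W}
    (hG : G.IsAcyclic) :
    ∃ (d : W → ℕ) (par : W → W), ∀ u v, G.Adj u v →
      (d v = d u + 1 ∧ par v = u) ∨ (d u = d v + 1 ∧ par u = v) := by
  have hr (v : W) : ∃ p : G.Walk (G.connectedComponentMk v).out v, p.IsPath :=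
    (SimpleGraph.ConnectedComponent.exact (G.connectedComponentMk v).out_eq).exists_isPath
  choose p hp using hr
  refine ⟨fun v => (p v).length, fun v => (p v).penultimate, fun u v h => ?_⟩
  refine hG.length_penultimate_of_adj ?_ h (hp u) (hp v)
  rw [SimpleGraph.ConnectedComponent.connectedComponentMk_eq_of_adj h]

/-- A forest has a star 3-coloring. -/
theorem SimpleGraph.IsAcyclic.exists_isStarColoring {W : Type*} {G : SimpleGraph W}
    (hG : G.IsAcyclic) : ∃ c : W → Fin 3, IsStarColoring G c := by
  obtain ⟨d, par, hd⟩ := hG.exists_depth_parent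
  refine ⟨fun v => ⟨d v % 3, Nat.mod_lt _ (by norm_num)⟩, fun u v h => ?_, ?_⟩
  · have := hd u v h
    simp only [ne_eq, Fin.mk.injEq]
    omega
  · rintro u v w x - huw - - hvx - huv hvw hwx ⟨h₁, h₂⟩
    simp only [Fin.mk.injEq] at h₁ h₂
    have h₃ := hd u v huv
    have h₄ := hd v w hvw
    have h₅ := hd w x hwx
    grind

/-- Two distinct vertices of a 2-independent set have no common neighbor. -/
theorem TwoIndepSet.eq_of_adj {W : Type*} {G : SimpleGraph W} {S : Set W} (hS : TwoIndepSet G S)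
    {u v w : W} (hu : u ∈ S) (hw : w ∈ S) (huv : G.Adj u v) (hvw : G.Adj v w) : u = w :=
  by_contra fun h => (hS u hu w hw h).2 v ⟨huv, hvw⟩

/-- Adjacent vertices do not both lie in a 2-independent set. -/
theorem TwoIndepSet.notMem_of_adj {W : Type*} {G : SimpleGraph W} {S : Set W}
    (hS : TwoIndepSet G S) {u v : W} (hu : u ∈ S) (huv : G.Adj u v) : v ∉ S :=
  fun hv => (hS u hu v hv huv.ne).1 huv

/-- A finite simple graph with an FII-partition admits a star 5-coloring. -/
theorem star_five_colorable_of_fiiPartition {V : Type*} [Fintype V]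
    (G : SimpleGraph V) (F A B : Set V) (h : IsFIIPartition G F A B) :
    ∃ c : V → Fin 5, IsStarColoring G c := by
  obtain ⟨hcov, -, -, -, hF, hA, hB⟩ := h
  obtain ⟨f, hf, hf'⟩ := hF.exists_isStarColoring
  let c : V → Fin 5 := fun v =>
    if hv : v ∈ F then (f ⟨v, hv⟩).castLE (by norm_num) else if v ∈ A then 3 else 4
  have key (u v : V) (h : c u = c v) :
      (u ∈ A ∧ v ∈ A) ∨ (u ∈ B ∧ v ∈ B) ∨
        ∃ (hu : u ∈ F) (hv : v ∈ F), f ⟨u, hu⟩ = f ⟨v, hv⟩ := by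
    have hu := hcov u
    have hv := hcov v
    simp only [c, Fin.ext_iff] at h
    split_ifs at h <;> simp at h <;> grind
  refine ⟨c, fun u v huv h => ?_, ?_⟩
  · rcases key u v h with ⟨hu, hv⟩ | ⟨hu, hv⟩ | ⟨hu, hv, h⟩
    · exact hA.notMem_of_adj hu huv hv
    · exact hB.notMem_of_adj hu huv hv
    · exact hf ⟨u, hu⟩ ⟨v, hv⟩ huv h
  · rintro u v w x nuv nuw nux nvw nvx nwx huv hvw hwx ⟨h₁, h₂⟩
    rcases key u w h₁ with ⟨hu, hw⟩ | ⟨hu, hw⟩ | ⟨hu, hw, h₁⟩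
    · exact nuw (hA.eq_of_adj hu hw huv hvw)
    · exact nuw (hB.eq_of_adj hu hw huv hvw)
    rcases key v x h₂ with ⟨hv, hx⟩ | ⟨hv, hx⟩ | ⟨hv, hx, h₂⟩
    · exact nvx (hA.eq_of_adj hv hx hvw hwx)
    · exact nvx (hB.eq_of_adj hv hx hvw hwx)
    exact hf' ⟨u, hu⟩ ⟨v, hv⟩ ⟨w, hw⟩ ⟨x, hx⟩ (by simpa) (by simpa) (by simpa) (by simpa)
      (by simpa) (by simpa) huv hvw hwx ⟨h₁, h₂⟩
end

section
/- Every finite forest (finite simple acyclic graph) admits a star 3-coloring. -/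
open scoped Classical

/-- In an acyclic graph, a vertex reachable from `r` has at most one neighbor closer to `r`. -/
theorem SimpleGraph.IsAcyclic.eq_of_adj_of_dist_add_one_eq {V : Type*} {G : SimpleGraph V}
    (hG : G.IsAcyclic) {r u v w : V} (hr : G.Reachable r v) (hu : G.Adj u v) (hw : G.Adj w v)
    (hdu : G.dist r u + 1 = G.dist r v) (hdw : G.dist r w + 1 = G.dist r v) : u = w := by
  obtain ⟨p, hp⟩ := hr.exists_isPath
  have penultimate_of_closer : ∀ x, G.Adj x v → G.dist r x + 1 = G.dist r v →
      x = p.penultimate := by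
    intro x hx hd
    obtain ⟨q, hq, hql⟩ := (hr.trans hx.symm.reachable).exists_path_of_dist
    have hv : v ∉ q.support := fun hmem ↦ by
      have h₁ := SimpleGraph.dist_le (q.takeUntil v hmem)
      have h₂ := q.length_takeUntil_le_length hmem
      omega
    have hpq := (hG.subsingleton_path r v).elim ⟨p, hp⟩ ⟨q.concat hx, hq.concat hv hx⟩
    rw [Subtype.mk.injEq] at hpq
    rw [hpq, SimpleGraph.Walk.penultimate_concat]
  rw [penultimate_of_closer u hu hdu, penultimate_of_closer w hw hdw]

/-- Every finite forest (finite simple acyclic graph) admits a star 3-coloring. -/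
theorem star_three_colorable_of_isAcyclic {V : Type*} [Fintype V]
    (G : SimpleGraph V) (hG : G.IsAcyclic) :
    ∃ c : V → Fin 3, IsStarColoring G c := by
  let root : V → V := fun v ↦ (G.connectedComponentMk v).out
  have root_reachable : ∀ v, G.Reachable (root v) v := fun v ↦
    SimpleGraph.ConnectedComponent.exact (Quot.out_eq (G.connectedComponentMk v))
  have root_eq : ∀ {u v}, G.Adj u v → root u = root v := fun h ↦
    congrArg Quot.out (SimpleGraph.ConnectedComponent.sound h.reachable)
  let depth : V → ℕ := fun v ↦ G.dist (root v) v
  have depth_adj : ∀ {u v}, G.Adj u v → depth u = depth v + 1 ∨ depth v = depth u + 1 := by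
    intro u v h
    have hd := hG.dist_eq_dist_add_one_of_adj_of_reachable (root u) h (root_reachable u)
    simpa only [depth, ← root_eq h] using hd
  have parent_unique : ∀ {u v w}, G.Adj u v → G.Adj w v → depth u + 1 = depth v →
      depth w + 1 = depth v → u = w := by
    intro u v w hu hw hdu hdw
    simp only [depth, root_eq hu, root_eq hw] at hdu hdw
    exact hG.eq_of_adj_of_dist_add_one_eq (root_reachable v) hu hw hdu hdw
  refine ⟨fun v ↦ ⟨depth v % 3, Nat.mod_lt _ (by norm_num)⟩, ?_, ?_⟩
  · intro u v h
    have := depth_adj h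
    simp only [ne_eq, Fin.mk.injEq]
    omega
  · intro u v w x _ huw _ _ hvx _ huv hvw hwx
    simp only [Fin.mk.injEq]
    rintro ⟨hcu, hcv⟩
    have h₁ := depth_adj huv
    have h₂ := depth_adj hvw
    have h₃ := depth_adj hwx
    rcases h₁ with h₁ | h₁
    · exact hvx (parent_unique hvw hwx.symm (by omega) (by omega))
    · exact huw (parent_unique huv hvw.symm (by omega) (by omega))
end

section
/- Let H be a finite simple graph with an FII-partition F ⊔ Iα ⊔ Iβ. Suppose v*, w1, a1, a2, b1, b2 are six distinct vertices of H such that w1 is adjacent to each of v*, a1, a2, b1, b2; a1 is adjacent to a2; b1 is adjacent to b2; and each of a1, a2, b1, b2 has degree exactly 2 in H (so w1 a1 a2 and w1 b1 b2 are two pendent triangles at w1). If v* ∈ Iα, then w1 ∈ Iβ. -/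
open scoped Classical

/-- A set inducing an acyclic subgraph misses a vertex of every triangle. -/
theorem not_mem_of_triangle_of_isAcyclic {W : Type*} {G : SimpleGraph W} {F : Set W}
    (hF : (G.induce F).IsAcyclic) {x y z : W} (hxy : G.Adj x y) (hyz : G.Adj y z)
    (hzx : G.Adj z x) (hx : x ∈ F) (hy : y ∈ F) : z ∉ F := by
  intro hz
  have exy : (G.induce F).Adj ⟨x, hx⟩ ⟨y, hy⟩ := hxy
  have eyz : (G.induce F).Adj ⟨y, hy⟩ ⟨z, hz⟩ := hyz
  have ezx : (G.induce F).Adj ⟨z, hz⟩ ⟨x, hx⟩ := hzx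
  refine hF (.cons exy (.cons eyz (.cons ezx .nil))) ?_
  simp [SimpleGraph.Walk.cons_isCycle_iff, hxy.ne, hxy.ne', hyz.ne, hzx.ne, hzx.ne']

/-- Lemma 1.5 (i): in a graph with an FII-partition `F ⊔ A ⊔ B`, if `w1` carries two
pendent triangles `w1 a1 a2` and `w1 b1 b2` and is adjacent to `v*`, and `v* ∈ A`,
then `w1 ∈ B`. -/
theorem mem_B_of_two_pendent_triangles {V : Type*} [Fintype V] (H : SimpleGraph V)
    (F A B : Set V) (hFII : IsFIIPartition H F A B)
    (vstar w1 a1 a2 b1 b2 : V)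
    (hdist : List.Pairwise (· ≠ ·) [vstar, w1, a1, a2, b1, b2])
    (hw1v : H.Adj w1 vstar)
    (hw1a1 : H.Adj w1 a1) (hw1a2 : H.Adj w1 a2)
    (hw1b1 : H.Adj w1 b1) (hw1b2 : H.Adj w1 b2)
    (ha : H.Adj a1 a2) (hb : H.Adj b1 b2)
    (hda1 : H.degree a1 = 2) (hda2 : H.degree a2 = 2)
    (hdb1 : H.degree b1 = 2) (hdb2 : H.degree b2 = 2)
    (hv : vstar ∈ A) : w1 ∈ B := by
  obtain ⟨hcover, -, -, -, hF, hA, hB⟩ := hFII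
  simp only [List.pairwise_cons, List.mem_cons, List.not_mem_nil, or_false, forall_eq_or_imp,
    forall_eq] at hdist
  obtain ⟨⟨-, hva1, hva2, hvb1, hvb2⟩, -, ⟨-, h11, h12⟩, ⟨h21, h22⟩, -⟩ := hdist
  by_contra hw1B
  have hw1A : w1 ∉ A := fun h => (hA w1 h vstar hv hw1v.ne).1 hw1v
  have hw1F : w1 ∈ F := by
    have := hcover w1
    tauto
  have not_mem_A : ∀ x, H.Adj w1 x → vstar ≠ x → x ∉ A := fun x hx hne h =>
    (hA vstar hv x h hne).2 w1 ⟨hw1v.symm, hx⟩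
  have mem_B : ∀ x y, H.Adj w1 x → H.Adj w1 y → H.Adj x y → vstar ≠ x → vstar ≠ y →
      x ∈ B ∨ y ∈ B := by
    intro x y hx hy hxy hvx hvy
    have hcx := hcover x
    have hcy := hcover y
    have hxA := not_mem_A x hx hvx
    have hyA := not_mem_A y hy hvy
    have hyF := not_mem_of_triangle_of_isAcyclic hF hx hxy hy.symm hw1F
    tauto
  have eq_of_mem_B : ∀ x y, H.Adj w1 x → H.Adj w1 y → x ∈ B → y ∈ B → x = y :=
    fun x y hx hy hxB hyB => by_contra fun hne => (hB x hxB y hyB hne).2 w1 ⟨hx.symm, hy⟩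
  rcases mem_B a1 a2 hw1a1 hw1a2 ha hva1 hva2 with h | h <;>
    rcases mem_B b1 b2 hw1b1 hw1b2 hb hvb1 hvb2 with h' | h'
  · exact h11 (eq_of_mem_B a1 b1 hw1a1 hw1b1 h h')
  · exact h12 (eq_of_mem_B a1 b2 hw1a1 hw1b2 h h')
  · exact h21 (eq_of_mem_B a2 b1 hw1a2 hw1b1 h h')
  · exact h22 (eq_of_mem_B a2 b2 hw1a2 hw1b2 h h')
end

section
/- Let H be a finite simple graph, let ρ_H(A) = 4|A| − 3·e(A) for vertex subsets A, and let ρ*_H(I) = min{ρ_H(K) : I ⊆ K ⊆ V(H)}. Then for all vertex subsets A and B of H, ρ*_H(A) + ρ*_H(B) ≥ ρ*_H(A ∪ B) + ρ*_H(A ∩ B). -/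
open scoped Classical

/-- The potential function `ρ_G(A) = 4|A| - 3·e(A)`. -/
noncomputable def potFn {W : Type*} [Fintype W] (G : SimpleGraph W) (A : Finset W) : ℤ :=
  4 * A.card - 3 * edgesIn G A

/-- `ρ*_G(I) = min { ρ_G(K) : I ⊆ K ⊆ V(G) }`. -/
noncomputable def potStar {W : Type*} [Fintype W] (G : SimpleGraph W) (I : Finset W) : ℤ :=
  (Finset.univ.filter fun K : Finset W => I ⊆ K).inf' ⟨Finset.univ, by simp⟩ (potFn G)

/-- The edge count is supermodular. -/
theorem edgesIn_add_le {W : Type*} [Fintype W] (G : SimpleGraph W) (K L : Finset W) :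
    edgesIn G K + edgesIn G L ≤ edgesIn G (K ∪ L) + edgesIn G (K ∩ L) := by
  unfold edgesIn
  rw [← Finset.card_union_add_card_inter]
  refine add_le_add (Finset.card_le_card fun e he => ?_) (Finset.card_le_card fun e he => ?_)
  · simp only [Finset.mem_union, Finset.mem_filter, Finset.mem_univ, true_and] at he ⊢
    grind
  · simp only [Finset.mem_inter, Finset.mem_filter, Finset.mem_univ, true_and] at he ⊢
    grind

/-- The potential function is submodular. -/
theorem potFn_union_add_inter_le {W : Type*} [Fintype W] (G : SimpleGraph W) (K L : Finset W) :
    potFn G (K ∪ L) + potFn G (K ∩ L) ≤ potFn G K + potFn G L := by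
  have hcard := Finset.card_union_add_card_inter K L
  have hedges := edgesIn_add_le G K L
  unfold potFn
  omega

theorem potStar_le_potFn {W : Type*} [Fintype W] (G : SimpleGraph W) {I K : Finset W}
    (h : I ⊆ K) : potStar G I ≤ potFn G K :=
  Finset.inf'_le _ (by simpa using h)

theorem exists_potStar_eq {W : Type*} [Fintype W] (G : SimpleGraph W) (I : Finset W) :
    ∃ K, I ⊆ K ∧ potStar G I = potFn G K := by
  obtain ⟨K, hK, h⟩ := Finset.exists_mem_eq_inf'
    (s := Finset.univ.filter fun K : Finset W => I ⊆ K) ⟨Finset.univ, by simp⟩ (potFn G)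
  exact ⟨K, by simpa using hK, h⟩

/-- Submodularity of `ρ*`:
`ρ*_H(A) + ρ*_H(B) ≥ ρ*_H(A ∪ B) + ρ*_H(A ∩ B)`. -/
theorem potStar_union_inter_le {V : Type*} [Fintype V] (H : SimpleGraph V)
    (A B : Finset V) :
    potStar H (A ∪ B) + potStar H (A ∩ B) ≤ potStar H A + potStar H B := by
  obtain ⟨K, hAK, hK⟩ := exists_potStar_eq H A
  obtain ⟨L, hBL, hL⟩ := exists_potStar_eq H B
  rw [hK, hL]
  exact (add_le_add (potStar_le_potFn H (Finset.union_subset_union hAK hBL))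
    (potStar_le_potFn H (Finset.inter_subset_inter hAK hBL))).trans
    (potFn_union_add_inter_le H K L)
end

section
/- Let H be a finite simple graph with mad(H) ≤ 8/3 (i.e., 3·e(A) ≤ 4·|A| for every vertex subset A), and let S and T be disjoint vertex subsets of H such that every vertex not in S that is adjacent to a vertex of S belongs to T. Then ρ*_{H−S}(T) ≥ −4·|S| + 3·m, where H−S is the graph obtained from H by deleting the vertices of S, m is the number of edges of H incident with at least one vertex of S, and ρ*_{H−S}(T) = min{4|K| − 3·e_{H−S}(K) : T ⊆ K ⊆ V(H−S)}. -/
open scoped Classical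

/-- If `K` is disjoint from `S` and contains every neighbour of `S` outside `S`, then the edges
inside `K ∪ S` are the edges inside `K` together with the edges incident with `S`. -/
theorem edgesIn_union_eq {V : Type*} [Fintype V] (H : SimpleGraph V) {K S : Finset V}
    (hdisj : Disjoint K S) (hK : ∀ v, v ∉ S → (∃ u ∈ S, H.Adj u v) → v ∈ K) :
    edgesIn H (K ∪ S) = edgesIn H K +
      (Finset.univ.filter fun e : Sym2 V => e ∈ H.edgeSet ∧ ∃ v ∈ e, v ∈ S).card := by
  unfold edgesIn
  rw [← Finset.card_union_of_disjoint]
  · congr 1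
    ext e
    induction e using Sym2.ind with
    | _ a b =>
      have ha := hK a
      have hb := hK b
      simp only [Finset.mem_filter, Finset.mem_univ, true_and, Finset.mem_union,
        SimpleGraph.mem_edgeSet, Sym2.mem_iff, forall_eq_or_imp, forall_eq,
        exists_eq_or_imp, exists_eq_left]
      constructor
      · tauto
      · rintro (h | ⟨hab, h | h⟩)
        · tauto
        · have := fun hn => hb hn ⟨a, h, hab⟩
          tauto
        · have := fun hn => ha hn ⟨b, h, hab.symm⟩
          tauto
  · refine Finset.disjoint_filter.2 fun e _ h₁ h₂ => ?_
    obtain ⟨v, hv, hvS⟩ := h₂.2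
    exact Finset.disjoint_left.1 hdisj (h₁.2 v hv) hvS

/-- If `mad(H) ≤ 8/3` and `S`, `T` are disjoint vertex sets such that every vertex
outside `S` adjacent to an `S`-vertex lies in `T`, then
`ρ*_{H−S}(T) ≥ -4|S| + 3·m`, where `m` is the number of edges incident with `S`.
Here `ρ*_{H−S}(T)` is the minimum of `ρ(K) = 4|K| - 3·e(K)` over sets `K` with
`T ⊆ K ⊆ V(H) \ S` (for such `K`, the edges of `H − S` inside `K` are exactly the
edges of `H` inside `K`). -/
theorem potStar_deleted_ge {V : Type*} [Fintype V] (H : SimpleGraph V)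
    (S T : Finset V)
    (hmad : ∀ A : Finset V, 3 * edgesIn H A ≤ 4 * A.card)
    (hdisj : Disjoint S T)
    (hT : ∀ v, v ∉ S → (∃ u ∈ S, H.Adj u v) → v ∈ T) :
    -4 * (S.card : ℤ) +
        3 * ((Finset.univ.filter fun e : Sym2 V => e ∈ H.edgeSet ∧ ∃ v ∈ e, v ∈ S).card : ℤ) ≤
      sInf {x : ℤ | ∃ K : Finset V, T ⊆ K ∧ Disjoint K S ∧ x = potFn H K} := by
  refine le_csInf ⟨_, T, subset_rfl, hdisj.symm, rfl⟩ ?_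
  rintro _ ⟨K, hTK, hKS, rfl⟩
  have hmad' := hmad (K ∪ S)
  rw [edgesIn_union_eq H hKS fun v hv h => hTK (hT v hv h),
    Finset.card_union_of_disjoint hKS] at hmad'
  unfold potFn
  lia
end

section
/- For every positive integer n, there exists a finite simple graph G with exactly 17n vertices and 23n edges such that 17·e(A) ≤ 23·|A| for every vertex subset A of G (so mad(G) = 46/17), and G has no FII-partition. (Such a graph is obtained from a cycle v_0, …, v_{5n−1} of length 5n by attaching two pendent triangles to v_i whenever i mod 5 ∈ {1,2,3}.) -/
open scoped Classical

/-- A finite nonempty set of vertices inside `F`, each with two neighbours in the set, forces a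
cycle in the subgraph induced on `F`. -/
theorem not_isAcyclic_induce_of_two_adj {W : Type*} [Finite W] {G : SimpleGraph W} {F S : Set W}
    (hSF : S ⊆ F) (hne : S.Nonempty)
    (hS : ∀ v ∈ S, ∃ a ∈ S, ∃ b ∈ S, a ≠ b ∧ G.Adj v a ∧ G.Adj v b) :
    ¬(G.induce F).IsAcyclic := by
  intro hF
  have hac : (G.induce S).IsAcyclic := hF.embedding (SimpleGraph.induceHomOfLE G hSF)
  have : Nonempty S := hne.to_subtype
  obtain ⟨u, v, p, hp, hmax⟩ :=
    SimpleGraph.Walk.exists_isPath_forall_isPath_length_le_length (G.induce S)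
  have eq_snd : ∀ w, (G.induce S).Adj u w → w = p.snd := by
    intro w hw
    by_cases hws : w ∈ p.support
    · exact hac.eq_snd_of_adj_start hp hw hws
    · have := hmax w v (p.cons hw.symm) (hp.cons hws)
      simp at this
  obtain ⟨a, ha, b, hb, hab, hua, hub⟩ := hS u u.2
  exact hab (congrArg Subtype.val ((eq_snd ⟨a, ha⟩ hua).trans (eq_snd ⟨b, hb⟩ hub).symm))

/-- A 2-independent set contains at most one vertex of each closed neighbourhood. -/
theorem TwoIndepSet.eq_of_closed_neighbors {W : Type*} {G : SimpleGraph W} {S : Set W}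
    (hS : TwoIndepSet G S) {x u v : W} (hxu : x = u ∨ G.Adj x u) (hxv : x = v ∨ G.Adj x v)
    (hu : u ∈ S) (hv : v ∈ S) : u = v := by
  by_contra huv
  obtain ⟨hadj, hcommon⟩ := hS u hu v hv huv
  rcases hxu with rfl | hxu
  · exact hxv.elim huv hadj
  · rcases hxv with rfl | hxv
    · exact hadj hxu.symm
    · exact hcommon x ⟨hxu.symm, hxv⟩

namespace IsFIIPartition

variable {W : Type*} {G : SimpleGraph W} {F A B : Set W}

/-- Among three vertices of a closed neighbourhood, at least one lies in the forest part. -/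
theorem mem_forest_of_closed_neighbors (h : IsFIIPartition G F A B) {x u v w : W}
    (hxu : x = u ∨ G.Adj x u) (hxv : x = v ∨ G.Adj x v) (hxw : x = w ∨ G.Adj x w)
    (huv : u ≠ v) (huw : u ≠ w) (hvw : v ≠ w) (hu : u ∉ F) (hv : v ∉ F) : w ∈ F := by
  obtain ⟨hcover, -, -, -, -, hA, hB⟩ := h
  by_contra hw
  have two {S : Set W} (hS : TwoIndepSet G S) :
      ¬(u ∈ S ∧ v ∈ S) ∧ ¬(u ∈ S ∧ w ∈ S) ∧ ¬(v ∈ S ∧ w ∈ S) :=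
    ⟨fun h ↦ huv (hS.eq_of_closed_neighbors hxu hxv h.1 h.2),
      fun h ↦ huw (hS.eq_of_closed_neighbors hxu hxw h.1 h.2),
      fun h ↦ hvw (hS.eq_of_closed_neighbors hxv hxw h.1 h.2)⟩
  have := two hA
  have := two hB
  have := (hcover u).resolve_left hu
  have := (hcover v).resolve_left hv
  have := (hcover w).resolve_left hw
  grind only

/-- The forest part does not contain all three vertices of a triangle. -/
theorem exists_notMem_forest_of_triangle [Finite W] (h : IsFIIPartition G F A B) {x p q : W}
    (hxp : G.Adj x p) (hxq : G.Adj x q) (hpq : G.Adj p q) (hx : x ∈ F) :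
    ∃ u, (u = p ∨ u = q) ∧ u ∉ F := by
  by_contra! hF
  refine not_isAcyclic_induce_of_two_adj (S := {x, p, q}) ?_ ⟨x, by simp⟩ ?_ h.2.2.2.2.1
  · rintro v (rfl | rfl | rfl)
    exacts [hx, hF _ (.inl rfl), hF _ (.inr rfl)]
  · rintro v (rfl | rfl | rfl)
    · exact ⟨p, by simp, q, by simp, hpq.ne, hxp, hxq⟩
    · exact ⟨x, by simp, q, by simp, hxq.ne, hxp.symm, hpq⟩
    · exact ⟨x, by simp, p, by simp, hxp.ne, hxq.symm, hpq.symm⟩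

/-- If a forest vertex lies in two triangles sharing only that vertex, then all of its other
neighbours are forest vertices. -/
theorem mem_forest_of_two_triangles [Finite W] (h : IsFIIPartition G F A B) {x p q r s y : W}
    (hxp : G.Adj x p) (hxq : G.Adj x q) (hpq : G.Adj p q)
    (hxr : G.Adj x r) (hxs : G.Adj x s) (hrs : G.Adj r s) (hxy : G.Adj x y)
    (hdisj : [p, q, r, s, y].Nodup) (hx : x ∈ F) : y ∈ F := by
  obtain ⟨u, hu, huF⟩ := h.exists_notMem_forest_of_triangle hxp hxq hpq hx
  obtain ⟨v, hv, hvF⟩ := h.exists_notMem_forest_of_triangle hxr hxs hrs hx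
  simp only [List.nodup_cons, List.mem_cons, List.not_mem_nil, not_or] at hdisj
  refine h.mem_forest_of_closed_neighbors (x := x) (u := u) (v := v) (.inr ?_) (.inr ?_) (.inr hxy)
    ?_ ?_ ?_ huF hvF
  · rcases hu with rfl | rfl <;> assumption
  · rcases hv with rfl | rfl <;> assumption
  all_goals grind

end IsFIIPartition

namespace TriangleCycle

/-- First endpoints, within their block, of the 23 edges of a block: the cycle vertices of the
block are `0, …, 4`, the others are the tips of the triangles pendent at `1`, `2`, `3`. -/
def src : Fin 23 → Fin 17 :=
  ![0, 1, 2, 3, 1, 1, 5, 1, 1, 7, 2, 2, 9, 2, 2, 11, 3, 3, 13, 3, 3, 15, 4]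

/-- Second endpoints of the 23 edges of a block; the last edge ends in the next block. -/
def tgt : Fin 23 → Fin 17 :=
  ![1, 2, 3, 4, 5, 6, 6, 7, 8, 8, 9, 10, 10, 11, 12, 12, 13, 14, 14, 15, 16, 16, 0]

variable {n : ℕ}

/-- The first endpoint of an edge, given by its block and its index in the block. -/
def fst (e : ZMod n × Fin 23) : ZMod n × Fin 17 := (e.1, src e.2)

/-- The second endpoint of an edge, given by its block and its index in the block. -/
def snd (e : ZMod n × Fin 23) : ZMod n × Fin 17 :=
  (if e.2 = 22 then e.1 + 1 else e.1, tgt e.2)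

/-- The edges of the cycle of length `5n` with pendent triangles. -/
def edge (e : ZMod n × Fin 23) : Sym2 (ZMod n × Fin 17) := s(fst e, snd e)

/-- The cycle of length `5n`, split into `n` blocks of five consecutive vertices, with two
triangles pendent at each of the three inner vertices of every block. -/
def graph (n : ℕ) : SimpleGraph (ZMod n × Fin 17) := .fromEdgeSet (Set.range edge)

theorem src_ne_tgt : ∀ j, src j ≠ tgt j := by decide

theorem eq_of_src_eq_of_tgt_eq : ∀ i j, src i = src j → tgt i = tgt j → i = j := by decide

theorem src_ne_tgt_or_tgt_ne_src : ∀ i j, src i = tgt j → tgt i ≠ src j := by decide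

theorem fst_ne_snd (e : ZMod n × Fin 23) : fst e ≠ snd e :=
  fun h ↦ src_ne_tgt e.2 (congrArg Prod.snd h)

theorem edge_injective : Function.Injective (edge (n := n)) := by
  intro e f hef
  rcases Sym2.eq_iff.mp hef with ⟨h₁, h₂⟩ | ⟨h₁, h₂⟩
  · exact Prod.ext (congrArg (fun v ↦ v.1) h₁)
      (eq_of_src_eq_of_tgt_eq _ _ (congrArg Prod.snd h₁) (congrArg Prod.snd h₂))
  · exact absurd (congrArg Prod.snd h₂)
      (src_ne_tgt_or_tgt_ne_src _ _ (congrArg Prod.snd h₁))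

theorem mem_edgeSet_graph {e : Sym2 (ZMod n × Fin 17)} :
    e ∈ (graph n).edgeSet ↔ ∃ f, edge f = e := by
  rw [graph, SimpleGraph.edgeSet_fromEdgeSet, Set.mem_sdiff, Set.mem_range]
  refine and_iff_left_of_imp ?_
  rintro ⟨f, rfl⟩
  exact fst_ne_snd f

theorem adj_fst_snd (e : ZMod n × Fin 23) : (graph n).Adj (fst e) (snd e) :=
  mem_edgeSet_graph.mpr ⟨e, rfl⟩

/-- Adjacency inside a block. -/
theorem adj_of_mem_block (b : ZMod n) {k l : Fin 17}
    (h : ∃ j, j ≠ 22 ∧ (src j = k ∧ tgt j = l ∨ src j = l ∧ tgt j = k)) :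
    (graph n).Adj (b, k) (b, l) := by
  obtain ⟨j, hj, ⟨rfl, rfl⟩ | ⟨rfl, rfl⟩⟩ := h
  · simpa [fst, snd, hj] using adj_fst_snd (b, j)
  · simpa [fst, snd, hj] using (adj_fst_snd (b, j)).symm

theorem adj_next_block (b : ZMod n) : (graph n).Adj (b, 4) (b + 1, 0) :=
  adj_fst_snd (b, 22)

theorem edgesIn_graph [NeZero n] (A : Finset (ZMod n × Fin 17)) :
    edgesIn (graph n) A = (Finset.univ.filter fun e ↦ fst e ∈ A ∧ snd e ∈ A).card := by
  rw [edgesIn, ← Finset.card_image_of_injective _ edge_injective]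
  congr 1
  ext e
  simp only [Finset.mem_filter_univ, Finset.mem_image, mem_edgeSet_graph]
  constructor
  · rintro ⟨⟨f, rfl⟩, hf⟩
    exact ⟨f, ⟨hf _ (Sym2.mem_mk_left _ _), hf _ (Sym2.mem_mk_right _ _)⟩, rfl⟩
  · rintro ⟨f, ⟨h₁, h₂⟩, rfl⟩
    refine ⟨⟨f, rfl⟩, fun v hv ↦ ?_⟩
    rcases Sym2.mem_iff.mp hv with rfl | rfl <;> assumption

theorem edgesIn_graph_univ [NeZero n] : edgesIn (graph n) Finset.univ = 23 * n := by
  simp [edgesIn_graph, ZMod.card, mul_comm]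

/-- The discharging inequality in a block: `x` indicates the chosen vertices of the block and
`z` whether the first vertex of the next block is chosen. -/
theorem block_inequality (x : Fin 17 → Prop) (z : Prop) :
    17 * ∑ j, (if x (src j) ∧ (if j = 22 then z else x (tgt j)) then 1 else 0 : ℤ) ≤
      23 * ∑ k, (if x k then 1 else 0 : ℤ) +
        6 * ((if z then 1 else 0) - (if x 0 then 1 else 0)) := by
  have triangle (p q r : Prop) :
      17 * ((if p ∧ q then 1 else 0) + (if p ∧ r then 1 else 0) + (if q ∧ r then 1 else 0) : ℤ) ≤
        5 * (if p then 1 else 0) + 23 * (if q then 1 else 0) + 23 * (if r then 1 else 0) := by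
    split_ifs <;> simp_all
  have path (a b : ℤ) (ha : 0 ≤ a) (hb : 0 ≤ b) (hab : a + b = 17) (p q : Prop) :
      17 * (if p ∧ q then 1 else 0 : ℤ) ≤ a * (if p then 1 else 0) + b * (if q then 1 else 0) := by
    split_ifs <;> simp_all
  have e₁ := path 17 0 (by norm_num) (by norm_num) (by norm_num) (x 0) (x 1)
  have e₂ := path 13 4 (by norm_num) (by norm_num) (by norm_num) (x 1) (x 2)
  have e₃ := path 9 8 (by norm_num) (by norm_num) (by norm_num) (x 2) (x 3)
  have e₄ := path 5 12 (by norm_num) (by norm_num) (by norm_num) (x 3) (x 4)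
  have e₅ := path 11 6 (by norm_num) (by norm_num) (by norm_num) (x 4) z
  have t₁ := triangle (x 1) (x 5) (x 6)
  have t₂ := triangle (x 1) (x 7) (x 8)
  have t₃ := triangle (x 2) (x 9) (x 10)
  have t₄ := triangle (x 2) (x 11) (x 12)
  have t₅ := triangle (x 3) (x 13) (x 14)
  have t₆ := triangle (x 3) (x 15) (x 16)
  simp [-Finset.sum_boole, Fin.sum_univ_succ, src, tgt]
  linarith

theorem edgesIn_graph_le [NeZero n] (A : Finset (ZMod n × Fin 17)) :
    17 * edgesIn (graph n) A ≤ 23 * A.card := by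
  have hedges : (edgesIn (graph n) A : ℤ) =
      ∑ b, ∑ j, if fst (b, j) ∈ A ∧ snd (b, j) ∈ A then 1 else 0 := by
    rw [edgesIn_graph, Finset.card_filter, Fintype.sum_prod_type]
    push_cast
    rfl
  have hcard : (A.card : ℤ) = ∑ b, ∑ k, if (b, k) ∈ A then 1 else 0 := by
    rw [← Fintype.sum_prod_type' (f := fun b k ↦ if (b, k) ∈ A then (1 : ℤ) else 0)]
    simp
  have hshift : ∑ b : ZMod n, (if (b + 1, (0 : Fin 17)) ∈ A then 1 else 0 : ℤ) =
      ∑ b : ZMod n, if (b, (0 : Fin 17)) ∈ A then 1 else 0 :=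
    Equiv.sum_comp (Equiv.addRight (1 : ZMod n))
      fun b ↦ if (b, (0 : Fin 17)) ∈ A then (1 : ℤ) else 0
  have hblock (b : ZMod n) :
      17 * ∑ j, (if fst (b, j) ∈ A ∧ snd (b, j) ∈ A then 1 else 0 : ℤ) ≤
        23 * ∑ k, (if (b, k) ∈ A then 1 else 0 : ℤ) +
          6 * ((if (b + 1, (0 : Fin 17)) ∈ A then 1 else 0) -
            (if (b, (0 : Fin 17)) ∈ A then 1 else 0)) := by
    have hsnd (j : Fin 23) :
        snd (b, j) ∈ A ↔ if j = 22 then (b + 1, (0 : Fin 17)) ∈ A else (b, tgt j) ∈ A := by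
      by_cases hj : j = 22
      · subst hj
        rfl
      · simp [snd, hj]
    simp only [hsnd, fst]
    convert block_inequality (fun k ↦ (b, k) ∈ A) ((b + 1, 0) ∈ A)
  have hsum := Finset.sum_le_sum fun b (_ : b ∈ Finset.univ) ↦ hblock b
  simp only [Finset.sum_add_distrib, ← Finset.mul_sum, Finset.sum_sub_distrib] at hsum
  rw [hshift, sub_self, ← hedges, ← hcard] at hsum
  omega

theorem not_hasFIIPartition_graph [NeZero n] : ¬HasFIIPartition (graph n) := by
  rintro ⟨F, A, B, h⟩
  have nodup {b c : ZMod n} {p q r s y : Fin 17} (hk : [p, q, r, s, y].Nodup) :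
      [(b, p), (b, q), (b, r), (b, s), (c, y)].Nodup :=
    List.Nodup.of_map Prod.snd hk
  have from₁ (b : ZMod n) {y : Fin 17} (hy : y = 0 ∨ y = 2) (hF : (b, 1) ∈ F) : (b, y) ∈ F := by
    refine h.mem_forest_of_two_triangles (p := (b, 5)) (q := (b, 6)) (r := (b, 7)) (s := (b, 8))
      (adj_of_mem_block b ?_) (adj_of_mem_block b ?_) (adj_of_mem_block b ?_)
      (adj_of_mem_block b ?_) (adj_of_mem_block b ?_) (adj_of_mem_block b ?_)
      (adj_of_mem_block b ?_) (nodup ?_) hF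
    all_goals rcases hy with rfl | rfl <;> decide
  have from₂ (b : ZMod n) {y : Fin 17} (hy : y = 1 ∨ y = 3) (hF : (b, 2) ∈ F) : (b, y) ∈ F := by
    refine h.mem_forest_of_two_triangles (p := (b, 9)) (q := (b, 10)) (r := (b, 11)) (s := (b, 12))
      (adj_of_mem_block b ?_) (adj_of_mem_block b ?_) (adj_of_mem_block b ?_)
      (adj_of_mem_block b ?_) (adj_of_mem_block b ?_) (adj_of_mem_block b ?_)
      (adj_of_mem_block b ?_) (nodup ?_) hF
    all_goals rcases hy with rfl | rfl <;> decide
  have from₃ (b : ZMod n) {y : Fin 17} (hy : y = 2 ∨ y = 4) (hF : (b, 3) ∈ F) : (b, y) ∈ F := by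
    refine h.mem_forest_of_two_triangles (p := (b, 13)) (q := (b, 14)) (r := (b, 15)) (s := (b, 16))
      (adj_of_mem_block b ?_) (adj_of_mem_block b ?_) (adj_of_mem_block b ?_)
      (adj_of_mem_block b ?_) (adj_of_mem_block b ?_) (adj_of_mem_block b ?_)
      (adj_of_mem_block b ?_) (nodup ?_) hF
    all_goals rcases hy with rfl | rfl <;> decide
  have mem₂ (b : ZMod n) : (b, 2) ∈ F := by
    by_contra hF
    have h₁ : (b, 1) ∉ F := fun h₁ ↦ hF (from₁ b (.inr rfl) h₁)
    exact hF (from₃ b (.inl rfl) (h.mem_forest_of_closed_neighbors (x := (b, 2))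
      (.inr (adj_of_mem_block b (l := 1) (by decide))) (.inl rfl)
      (.inr (adj_of_mem_block b (by decide))) (by simp) (by simp) (by simp) h₁ hF))
  have mem₁ (b : ZMod n) : (b, 1) ∈ F := from₂ b (.inl rfl) (mem₂ b)
  have mem₃ (b : ZMod n) : (b, 3) ∈ F := from₂ b (.inr rfl) (mem₂ b)
  refine not_isAcyclic_induce_of_two_adj (G := graph n) (F := F) (S := {v | v.2 < 5}) ?_
    ⟨(0, 0), by simp⟩ ?_ h.2.2.2.2.1
  · rintro ⟨b, k⟩ (hk : k < 5)
    obtain rfl | rfl | rfl | rfl | rfl : k = 0 ∨ k = 1 ∨ k = 2 ∨ k = 3 ∨ k = 4 := by omega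
    exacts [from₁ b (.inl rfl) (mem₁ b), mem₁ b, mem₂ b, mem₃ b, from₃ b (.inr rfl) (mem₃ b)]
  · rintro ⟨b, k⟩ (hk : k < 5)
    obtain rfl | rfl | rfl | rfl | rfl : k = 0 ∨ k = 1 ∨ k = 2 ∨ k = 3 ∨ k = 4 := by omega
    · obtain ⟨c, rfl⟩ : ∃ c, c + 1 = b := ⟨b - 1, sub_add_cancel b 1⟩
      exact ⟨(c, 4), by simp, (c + 1, 1), by simp, by simp, (adj_next_block c).symm,
        adj_of_mem_block _ (by decide)⟩
    · exact ⟨(b, 0), by simp, (b, 2), by simp, by simp, adj_of_mem_block b (by decide),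
        adj_of_mem_block b (by decide)⟩
    · exact ⟨(b, 1), by simp, (b, 3), by simp, by simp, adj_of_mem_block b (by decide),
        adj_of_mem_block b (by decide)⟩
    · exact ⟨(b, 2), by simp, (b, 4), by simp, by simp, adj_of_mem_block b (by decide),
        adj_of_mem_block b (by decide)⟩
    · exact ⟨(b, 3), by simp, (b + 1, 0), by simp, by simp, adj_of_mem_block b (by decide),
        adj_next_block b⟩

end TriangleCycle

/-- For every positive integer `n` there is a finite simple graph with `17n` vertices and
`23n` edges whose every vertex subset `A` satisfies `17·e(A) ≤ 23·|A|`
(so its maximum average degree equals `46/17`), yet which has no FII-partition. -/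
theorem exists_no_fiiPartition_mad_46_div_17 :
    ∀ n : ℕ, 0 < n →
      ∃ (V : Type) (_ : Fintype V) (G : SimpleGraph V),
        Fintype.card V = 17 * n ∧
        edgesIn G Finset.univ = 23 * n ∧
        (∀ A : Finset V, 17 * edgesIn G A ≤ 23 * A.card) ∧
        ¬HasFIIPartition G := by
  intro n hn
  have : NeZero n := ⟨hn.ne'⟩
  exact ⟨ZMod n × Fin 17, inferInstance, TriangleCycle.graph n, by simp [ZMod.card, mul_comm],
    TriangleCycle.edgesIn_graph_univ, TriangleCycle.edgesIn_graph_le,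
    TriangleCycle.not_hasFIIPartition_graph⟩
end

section
/- Let G be a finite simple graph and let v be a vertex of degree exactly 3 whose three neighbors v1, v2, v3 all have degree exactly 2 in G. If the graph G − {v, v1, v2, v3} has an FII-partition, then G has an FII-partition. -/
open scoped Classical

/-- Adding a vertex with at most one neighbor in an induced forest gives an induced forest. -/
theorem SimpleGraph.isAcyclic_induce_insert {W : Type*} {G : SimpleGraph W} {S : Set W} {x : W}
    (hS : (G.induce S).IsAcyclic)
    (hx : ∀ a ∈ S, ∀ b ∈ S, G.Adj x a → G.Adj x b → a = b) :
    (G.induce (insert x S)).IsAcyclic := by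
  intro u c hc
  by_cases hxc : (⟨x, Set.mem_insert x S⟩ : ↥(insert x S)) ∈ c.support
  · have hr := hc.rotate hxc
    refine hr.snd_ne_penultimate ?_
    have h₁ := (c.rotate _ hxc).adj_snd hr.not_nil
    have h₂ := ((c.rotate _ hxc).adj_penultimate hr.not_nil).symm
    generalize (c.rotate _ hxc).snd = a at *
    generalize (c.rotate _ hxc).penultimate = b at *
    obtain ⟨a, rfl | ha⟩ := a
    · exact absurd h₁ (SimpleGraph.irrefl _)
    obtain ⟨b, rfl | hb⟩ := b
    · exact absurd h₂ (SimpleGraph.irrefl _)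
    exact Subtype.ext (hx a ha b hb h₁ h₂)
  · have hinj : Function.Injective (SimpleGraph.Embedding.induce (G := G) (insert x S)).toHom :=
      (SimpleGraph.Embedding.induce (G := G) (insert x S)).injective
    have hd := hc.map hinj
    generalize hdef : c.map (SimpleGraph.Embedding.induce (G := G) (insert x S)).toHom = d at hd
    have hdS : ∀ w ∈ d.support, w ∈ S := by
      intro w hw
      rw [← hdef, SimpleGraph.Walk.support_map, List.mem_map] at hw
      obtain ⟨⟨w', rfl | hw'⟩, hmem, rfl⟩ := hw
      · exact absurd hmem hxc
      · exact hw'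
    refine hS (d.induce S hdS) ?_
    rw [← SimpleGraph.Walk.isCycle_map_iff_of_injective
      (f := (SimpleGraph.Embedding.induce (G := G) S).toHom)
      (SimpleGraph.Embedding.induce (G := G) S).injective, SimpleGraph.Walk.map_induce]
    exact hd

theorem SimpleGraph.isAcyclic_induce_image_val {W : Type*} {G : SimpleGraph W} {T : Set W}
    {S : Set T} (hS : ((G.induce T).induce S).IsAcyclic) :
    (G.induce (Subtype.val '' S)).IsAcyclic := by
  have hT : ∀ x ∈ Subtype.val '' S, x ∈ T := by
    rintro _ ⟨x, -, rfl⟩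
    exact x.2
  have hS' : ∀ x (h : x ∈ Subtype.val '' S), (⟨x, hT x h⟩ : T) ∈ S := by
    rintro _ ⟨x, hx, rfl⟩
    exact hx
  exact hS.comap ⟨fun x => ⟨⟨x.1, hT x.1 x.2⟩, hS' x.1 x.2⟩, fun h => h⟩
    fun x y hxy => Subtype.ext (congrArg (fun z => z.1.1) hxy)

/-- A 2-independent set of `G - T` is one of `G` when no vertex of `T` joins two vertices
outside `T`. -/
theorem TwoIndepSet.image_val {W : Type*} {G : SimpleGraph W} {T : Set W} {S : Set ↥Tᶜ}
    (hS : TwoIndepSet (G.induce Tᶜ) S)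
    (hT : ∀ w ∈ T, ∀ a ∉ T, ∀ b ∉ T, G.Adj a w → G.Adj w b → a = b) :
    TwoIndepSet G (Subtype.val '' S) := by
  rintro _ ⟨a, ha, rfl⟩ _ ⟨b, hb, rfl⟩ hab
  have h := hS a ha b hb fun h => hab (congrArg _ h)
  refine ⟨h.1, fun w hw => ?_⟩
  by_cases hwT : w ∈ T
  · exact hab (hT w hwT a a.2 b b.2 hw.1 hw.2)
  · exact h.2 ⟨w, hwT⟩ hw

theorem TwoIndepSet.insert {W : Type*} {G : SimpleGraph W} {S : Set W} {x : W}
    (hS : TwoIndepSet G S)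
    (hx : ∀ a ∈ S, ¬G.Adj x a ∧ ∀ w, ¬(G.Adj x w ∧ G.Adj w a)) :
    TwoIndepSet G (insert x S) := by
  rintro a (rfl | ha) b (rfl | hb) hab
  · exact absurd rfl hab
  · exact hx b hb
  · exact ⟨fun h => (hx a ha).1 h.symm, fun w h => (hx a ha).2 w ⟨h.2.symm, h.1.symm⟩⟩
  · exact hS a ha b hb hab

theorem SimpleGraph.exists_eq_or_eq_of_degree_eq_two {W : Type*} [Fintype W] {G : SimpleGraph W}
    {v w : W} (hd : G.degree w = 2) (h : G.Adj v w) :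
    ∃ u, ∀ x, G.Adj w x → x = v ∨ x = u := by
  obtain ⟨a, b, -, hab⟩ := Finset.card_eq_two.mp hd
  have hmem : ∀ x, G.Adj w x ↔ x = a ∨ x = b := fun x => by
    rw [← G.mem_neighborFinset, hab]; simp
  rcases (hmem v).1 h.symm with rfl | rfl
  · exact ⟨b, fun x hx => (hmem x).1 hx⟩
  · exact ⟨a, fun x hx => ((hmem x).1 hx).symm⟩

/-- If no vertex of `A` is adjacent to a neighbor of `v`, then `v` can be added to `A` and its
neighbors to `F`. -/
theorem hasFIIPartition_of_insert_center {V : Type*} {G : SimpleGraph V}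
    {v v1 v2 v3 u1 u2 u3 : V} {F A B : Set V}
    (hv1 : v ≠ v1) (hv2 : v ≠ v2) (hv3 : v ≠ v3)
    (hNv : ∀ x, G.Adj v x → x = v1 ∨ x = v2 ∨ x = v3)
    (hN1 : ∀ x, G.Adj v1 x → x = v ∨ x = u1) (hN2 : ∀ x, G.Adj v2 x → x = v ∨ x = u2)
    (hN3 : ∀ x, G.Adj v3 x → x = v ∨ x = u3)
    (hcov : ∀ x, (x = v ∨ x = v1 ∨ x = v2 ∨ x = v3) ∨ x ∈ F ∨ x ∈ A ∨ x ∈ B)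
    (hTF : ∀ x ∈ F, x ≠ v ∧ x ≠ v1 ∧ x ≠ v2 ∧ x ≠ v3)
    (hTA : ∀ x ∈ A, x ≠ v ∧ x ≠ v1 ∧ x ≠ v2 ∧ x ≠ v3)
    (hTB : ∀ x ∈ B, x ≠ v ∧ x ≠ v1 ∧ x ≠ v2 ∧ x ≠ v3)
    (hFA : Disjoint F A) (hFB : Disjoint F B) (hAB : Disjoint A B)
    (hF : (G.induce F).IsAcyclic) (hA : TwoIndepSet G A) (hB : TwoIndepSet G B)
    (hfree : ∀ a ∈ A, ¬G.Adj v1 a ∧ ¬G.Adj v2 a ∧ ¬G.Adj v3 a) :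
    HasFIIPartition G := by
  rw [Set.disjoint_left] at hFA hFB hAB
  refine ⟨insert v3 (insert v2 (insert v1 F)), insert v A, B, ?_, ?_, ?_, ?_, ?_, ?_, hB⟩
  · intro x
    have := hcov x
    simp only [Set.mem_insert_iff]
    tauto
  · rw [Set.disjoint_left]
    grind
  · rw [Set.disjoint_left]
    grind
  · rw [Set.disjoint_left]
    grind
  · refine SimpleGraph.isAcyclic_induce_insert (SimpleGraph.isAcyclic_induce_insert
      (SimpleGraph.isAcyclic_induce_insert hF ?_) ?_) ?_ <;>
      grind
  · refine hA.insert fun a ha => ⟨?_, ?_⟩ <;> grind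

/-- If `v1` has a neighbor in `A` and `v2` has a neighbor in `B`, then `v` and its neighbors
can be added to `F`. -/
theorem hasFIIPartition_of_insert_all {V : Type*} {G : SimpleGraph V}
    {v v1 v2 v3 u1 u2 u3 : V} {F A B : Set V}
    (hNv : ∀ x, G.Adj v x → x = v1 ∨ x = v2 ∨ x = v3)
    (hN1 : ∀ x, G.Adj v1 x → x = v ∨ x = u1) (hN2 : ∀ x, G.Adj v2 x → x = v ∨ x = u2)
    (hN3 : ∀ x, G.Adj v3 x → x = v ∨ x = u3)
    (hcov : ∀ x, (x = v ∨ x = v1 ∨ x = v2 ∨ x = v3) ∨ x ∈ F ∨ x ∈ A ∨ x ∈ B)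
    (hTF : ∀ x ∈ F, x ≠ v ∧ x ≠ v1 ∧ x ≠ v2 ∧ x ≠ v3)
    (hTA : ∀ x ∈ A, x ≠ v ∧ x ≠ v1 ∧ x ≠ v2 ∧ x ≠ v3)
    (hTB : ∀ x ∈ B, x ≠ v ∧ x ≠ v1 ∧ x ≠ v2 ∧ x ≠ v3)
    (hFA : Disjoint F A) (hFB : Disjoint F B) (hAB : Disjoint A B)
    (hF : (G.induce F).IsAcyclic) (hA : TwoIndepSet G A) (hB : TwoIndepSet G B)
    (h1 : ∃ a ∈ A, G.Adj v1 a) (h2 : ∃ b ∈ B, G.Adj v2 b) :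
    HasFIIPartition G := by
  have hAB' := hAB
  rw [Set.disjoint_left] at hFA hFB hAB
  obtain ⟨a, ha, h1⟩ := h1
  obtain ⟨b, hb, h2⟩ := h2
  obtain rfl : a = u1 := (hN1 a h1).resolve_left (hTA a ha).1
  obtain rfl : b = u2 := (hN2 b h2).resolve_left (hTB b hb).1
  refine ⟨insert v2 (insert v1 (insert v (insert v3 F))), A, B, ?_, ?_, ?_, hAB', ?_, hA, hB⟩
  · intro x
    have := hcov x
    simp only [Set.mem_insert_iff]
    tauto
  · rw [Set.disjoint_left]
    grind
  · rw [Set.disjoint_left]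
    grind
  · refine SimpleGraph.isAcyclic_induce_insert (SimpleGraph.isAcyclic_induce_insert
      (SimpleGraph.isAcyclic_induce_insert (SimpleGraph.isAcyclic_induce_insert hF ?_) ?_) ?_) ?_
      <;> grind

/-- [C3] If `v` is a 3-vertex whose three neighbors `v1, v2, v3` all have degree 2, and
`G − {v, v1, v2, v3}` has an FII-partition, then so does `G`. -/
theorem hasFIIPartition_of_three_vertex_all_two_neighbors {V : Type*} [Fintype V]
    (G : SimpleGraph V) (v v1 v2 v3 : V)
    (hne : List.Pairwise (· ≠ ·) [v, v1, v2, v3])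
    (h1 : G.Adj v v1) (h2 : G.Adj v v2) (h3 : G.Adj v v3)
    (hdv : G.degree v = 3)
    (hd1 : G.degree v1 = 2) (hd2 : G.degree v2 = 2) (hd3 : G.degree v3 = 2)
    (h : HasFIIPartition (G.induce ({v, v1, v2, v3} : Set V)ᶜ)) :
    HasFIIPartition G := by
  have hNv : ∀ x, G.Adj v x → x = v1 ∨ x = v2 ∨ x = v3 := by
    have hne' : v1 ≠ v2 ∧ v1 ≠ v3 ∧ v2 ≠ v3 := by
      simp only [List.pairwise_cons, List.mem_cons] at hne
      grind
    have hsub : ({v1, v2, v3} : Finset V) ⊆ G.neighborFinset v := by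
      intro x hx
      simp only [Finset.mem_insert, Finset.mem_singleton] at hx
      rw [G.mem_neighborFinset]
      rcases hx with rfl | rfl | rfl <;> assumption
    have heq := Finset.eq_of_subset_of_card_le hsub (by
      rw [G.card_neighborFinset_eq_degree, hdv,
        Finset.card_eq_three.mpr ⟨v1, v2, v3, hne'.1, hne'.2.1, hne'.2.2, rfl⟩])
    intro x hx
    rw [← G.mem_neighborFinset, ← heq] at hx
    simpa using hx
  obtain ⟨u1, hN1⟩ := SimpleGraph.exists_eq_or_eq_of_degree_eq_two hd1 h1
  obtain ⟨u2, hN2⟩ := SimpleGraph.exists_eq_or_eq_of_degree_eq_two hd2 h2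
  obtain ⟨u3, hN3⟩ := SimpleGraph.exists_eq_or_eq_of_degree_eq_two hd3 h3
  have hT : ∀ w ∈ ({v, v1, v2, v3} : Set V), ∀ a ∉ ({v, v1, v2, v3} : Set V),
      ∀ b ∉ ({v, v1, v2, v3} : Set V), G.Adj a w → G.Adj w b → a = b := by
    intro w hw a ha b hb haw hwb
    have hwa := haw.symm
    simp only [Set.mem_insert_iff, Set.mem_singleton_iff, not_or] at hw ha hb
    grind
  obtain ⟨F, A, B, hcov, hFA, hFB, hAB, hF, hA, hB⟩ := h
  have hmem : ∀ (S : Set ↥({v, v1, v2, v3} : Set V)ᶜ), ∀ x ∈ Subtype.val '' S,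
      x ≠ v ∧ x ≠ v1 ∧ x ≠ v2 ∧ x ≠ v3 := by
    rintro S _ ⟨x, -, rfl⟩
    simpa only [Set.mem_compl_iff, Set.mem_insert_iff, Set.mem_singleton_iff, not_or] using x.2
  have hcov' : ∀ x, (x = v ∨ x = v1 ∨ x = v2 ∨ x = v3) ∨
      x ∈ Subtype.val '' F ∨ x ∈ Subtype.val '' A ∨ x ∈ Subtype.val '' B := by
    intro x
    by_cases hx : x ∈ ({v, v1, v2, v3} : Set V)
    · exact Or.inl (by simpa using hx)
    · exact Or.inr ((hcov ⟨x, hx⟩).imp (⟨_, ·, rfl⟩) (.imp (⟨_, ·, rfl⟩) (⟨_, ·, rfl⟩)))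
  have hTF := hmem F
  have hTA := hmem A
  have hTB := hmem B
  have hF' := SimpleGraph.isAcyclic_induce_image_val hF
  have hA' := hA.image_val hT
  have hB' := hB.image_val hT
  rw [← Set.disjoint_image_iff Subtype.val_injective] at hFA hFB hAB
  generalize Subtype.val '' F = F' at *
  generalize Subtype.val '' A = A' at *
  generalize Subtype.val '' B = B' at *
  by_cases hfA : ∀ a ∈ A', ¬G.Adj v1 a ∧ ¬G.Adj v2 a ∧ ¬G.Adj v3 a
  · exact hasFIIPartition_of_insert_center h1.ne h2.ne h3.ne hNv hN1 hN2 hN3 hcov' hTF hTA hTB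
      hFA hFB hAB hF' hA' hB' hfA
  by_cases hfB : ∀ b ∈ B', ¬G.Adj v1 b ∧ ¬G.Adj v2 b ∧ ¬G.Adj v3 b
  · exact hasFIIPartition_of_insert_center h1.ne h2.ne h3.ne hNv hN1 hN2 hN3
      (fun x => by rw [or_comm (a := x ∈ B')]; exact hcov' x) hTF hTB hTA hFB hFA hAB.symm
      hF' hB' hA' hfB
  have hA3 : (∃ a ∈ A', G.Adj v1 a) ∨ (∃ a ∈ A', G.Adj v2 a) ∨ ∃ a ∈ A', G.Adj v3 a := by grind
  have hB3 : (∃ b ∈ B', G.Adj v1 b) ∨ (∃ b ∈ B', G.Adj v2 b) ∨ ∃ b ∈ B', G.Adj v3 b := by grind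
  have hdiff : ∀ w u, (∀ x, G.Adj w x → x = v ∨ x = u) →
      (∃ a ∈ A', G.Adj w a) → (∃ b ∈ B', G.Adj w b) → False := by
    rintro w u hw ⟨a, ha, hwa⟩ ⟨b, hb, hwb⟩
    have hau := (hw a hwa).resolve_left (hTA a ha).1
    have hbu := (hw b hwb).resolve_left (hTB b hb).1
    exact Set.disjoint_left.1 hAB ha (hau.trans hbu.symm ▸ hb)
  have hall : ∀ p q r a b c, (∀ x, (x = p ∨ x = q ∨ x = r) ↔ (x = v1 ∨ x = v2 ∨ x = v3)) →
      (∀ x, G.Adj p x → x = v ∨ x = a) → (∀ x, G.Adj q x → x = v ∨ x = b) →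
      (∀ x, G.Adj r x → x = v ∨ x = c) →
      (∃ a ∈ A', G.Adj p a) → (∃ b ∈ B', G.Adj q b) → HasFIIPartition G := by
    intro p q r a b c hperm hp hq hr hpA hqB
    refine hasFIIPartition_of_insert_all (fun x hx => (hperm x).2 (hNv x hx)) hp hq hr
      (fun x => by rw [hperm]; exact hcov' x) ?_ ?_ ?_ hFA hFB hAB hF' hA' hB' hpA hqB
    · intro x hx
      simpa only [ne_eq, ← not_or, hperm] using hTF x hx
    · intro x hx
      simpa only [ne_eq, ← not_or, hperm] using hTA x hx
    · intro x hx
      simpa only [ne_eq, ← not_or, hperm] using hTB x hx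
  rcases hA3 with ha | ha | ha <;> rcases hB3 with hb | hb | hb
  · exact (hdiff v1 u1 hN1 ha hb).elim
  · exact hall v1 v2 v3 u1 u2 u3 (fun x => by tauto) hN1 hN2 hN3 ha hb
  · exact hall v1 v3 v2 u1 u3 u2 (fun x => by tauto) hN1 hN3 hN2 ha hb
  · exact hall v2 v1 v3 u2 u1 u3 (fun x => by tauto) hN2 hN1 hN3 ha hb
  · exact (hdiff v2 u2 hN2 ha hb).elim
  · exact hall v2 v3 v1 u2 u3 u1 (fun x => by tauto) hN2 hN3 hN1 ha hb
  · exact hall v3 v1 v2 u3 u1 u2 (fun x => by tauto) hN3 hN1 hN2 ha hb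
  · exact hall v3 v2 v1 u3 u2 u1 (fun x => by tauto) hN3 hN2 hN1 ha hb
  · exact (hdiff v3 u3 hN3 ha hb).elim
end
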